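/- Let f, g ∈ D(μ) satisfy |f(z)| ≤ |g(z)| for all z ∈ 𝔻. Then [f]_{D(μ)} ⊆ [g]_{D(μ)}. -/

import Mathlib

open MeasureTheory Metric Filter Complex Set
open scoped ENNReal Topology

noncomputable section

namespace DirichletMu

/-- The open unit disc in `ℂ`. -/
def disc : Set ℂ := Metric.ball 0 1

/-- The unit circle `𝕋`. -/
def circleT : Set ℂ := Metric.sphere 0 1

/-- The boundary point `e^{it}`. -/
def bpt (t : ℝ) : ℂ := Complex.exp (Complex.I * (t : ℂ))

/-- Arc-length parametrizing measure on `(0, 2π]`. -/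
def θm : Measure ℝ := volume.restrict (Set.Ioc 0 (2 * Real.pi))

/-- A measure is carried by the unit circle. -/
def OnCircle (μ : Measure ℂ) : Prop := μ circleTᶜ = 0

/-- The mean-square integrals of `f` over circles of radius `r < 1`. -/
def hardySet (f : ℂ → ℂ) : Set ℝ :=
  {x | ∃ r : ℝ, 0 < r ∧ r < 1 ∧
    x = (1 / (2 * Real.pi)) * ∫ t in (0:ℝ)..(2 * Real.pi), ‖f ((r : ℂ) * bpt t)‖ ^ 2}

/-- Membership in the Hardy space `H²`. -/
def MemHardy2 (f : ℂ → ℂ) : Prop :=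
  DifferentiableOn ℂ f disc ∧ BddAbove (hardySet f)

/-- The squared Hardy norm. -/
def hardyNormSq (f : ℂ → ℂ) : ℝ := sSup (hardySet f)

/-- Membership in `H^∞`. -/
def MemHinf (f : ℂ → ℂ) : Prop :=
  DifferentiableOn ℂ f disc ∧ ∃ C : ℝ, ∀ z ∈ disc, ‖f z‖ ≤ C

/-- The sup norm over the disc. -/
def supNorm (f : ℂ → ℂ) : ℝ := sSup ((fun z => ‖f z‖) '' disc)

/-- The Poisson integral of the measure `μ`. -/
def poissonMu (μ : Measure ℂ) (z : ℂ) : ℝ :=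
  ∫ ζ, (1 - ‖z‖ ^ 2) / ‖1 - (starRingEnd ℂ) ζ * z‖ ^ 2 ∂μ

/-- The integrand of the Dirichlet integral. -/
def dirichletDensity (μ : Measure ℂ) (f : ℂ → ℂ) (z : ℂ) : ℝ :=
  ‖deriv f z‖ ^ 2 * poissonMu μ z

/-- The Dirichlet integral `D_μ(f)`. -/
def dirichletIntegral (μ : Measure ℂ) (f : ℂ → ℂ) : ℝ :=
  (1 / Real.pi) * ∫ z in disc, dirichletDensity μ f z

/-- Membership in the Dirichlet-type space `D(μ)`. -/
def MemD (μ : Measure ℂ) (f : ℂ → ℂ) : Prop :=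
  MemHardy2 f ∧ IntegrableOn (dirichletDensity μ f) disc

/-- The squared norm `‖f‖_μ²` of `D(μ)`. -/
def dNormSq (μ : Measure ℂ) (f : ℂ → ℂ) : ℝ :=
  hardyNormSq f + dirichletIntegral μ f

/-- `f` has radial limit `L` at `ζ`. -/
def HasRadialLimitAt (f : ℂ → ℂ) (ζ L : ℂ) : Prop :=
  Tendsto (fun r : ℝ => f ((r : ℂ) * ζ)) (nhdsWithin 1 (Set.Iio 1)) (nhds L)

/-- The modulus of `f` has radial limit `m` at `e^{it}`. -/
def BoundaryAbs (f : ℂ → ℂ) (t : ℝ) (m : ℝ) : Prop :=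
  Tendsto (fun r : ℝ => ‖f ((r : ℂ) * bpt t)‖) (nhdsWithin 1 (Set.Iio 1)) (nhds m)

/-- The boundary zero set `Z_𝕋(f)`. -/
def ZT (f : ℂ → ℂ) : Set ℂ :=
  {ζ | ζ ∈ circleT ∧ HasRadialLimitAt f ζ 0}

/-- The set `Z̲(f)`. -/
def Zlow (f : ℂ → ℂ) : Set ℂ :=
  {ζ | ζ ∈ Metric.closedBall (0 : ℂ) 1 ∧
    Filter.liminf (fun z => ‖f z‖) (nhdsWithin ζ disc) = 0}

def ZlowSet (S : Set (ℂ → ℂ)) : Set ℂ := ⋂ f ∈ S, Zlow f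

def ZTSet (S : Set (ℂ → ℂ)) : Set ℂ := ⋂ f ∈ S, ZT f

/-- `[f]_{D(μ)}`: the closure in `D(μ)` of the polynomial multiples of `f`. -/
def closedSpan (μ : Measure ℂ) (f : ℂ → ℂ) : Set (ℂ → ℂ) :=
  {g | MemD μ g ∧ ∀ ε > 0, ∃ q : Polynomial ℂ,
    dNormSq μ (fun z => g z - q.eval z * f z) < ε}

/-- `f` is cyclic for `D(μ)`. -/
def IsCyclic (μ : Measure ℂ) (f : ℂ → ℂ) : Prop :=
  closedSpan μ f = {g | MemD μ g}

/-- `f` is the outer function with boundary modulus `φ` (parametrized by `e^{it}`). -/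
def OuterWith (f : ℂ → ℂ) (φ : ℝ → ℝ) : Prop :=
  (∀ t, 0 ≤ φ t) ∧
  IntervalIntegrable (fun t => Real.log (φ t)) volume 0 (2 * Real.pi) ∧
  ∀ z ∈ disc, f z = Complex.exp (((2 * Real.pi : ℝ) : ℂ)⁻¹ *
    ∫ t in (0:ℝ)..(2 * Real.pi), ((bpt t + z) / (bpt t - z)) * (Real.log (φ t) : ℂ))

/-- `f` is an outer function. -/
def IsOuter (f : ℂ → ℂ) : Prop := ∃ φ, OuterWith f φ

/-- Inner functions. -/
def IsInner (f : ℂ → ℂ) : Prop :=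
  DifferentiableOn ℂ f disc ∧ (∀ z ∈ disc, ‖f z‖ ≤ 1) ∧
  ∀ᵐ t ∂θm, BoundaryAbs f t 1

/-- `f / Θ ∈ H²`. -/
def InnerDivides (Θ f : ℂ → ℂ) : Prop :=
  ∃ g, MemHardy2 g ∧ ∀ z ∈ disc, f z = Θ z * g z

/-- `Θ / Θ'` is bounded on the disc. -/
def DividesBdd (Θ' Θ : ℂ → ℂ) : Prop :=
  ∃ g, MemHinf g ∧ ∀ z ∈ disc, Θ z = Θ' z * g z

/-- `Θ` is the greatest common inner divisor of the family `M`. -/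
def IsGCDInner (M : Set (ℂ → ℂ)) (Θ : ℂ → ℂ) : Prop :=
  IsInner Θ ∧ (∀ f ∈ M, InnerDivides Θ f) ∧
  ∀ Θ', IsInner Θ' → (∀ f ∈ M, InnerDivides Θ' f) → DividesBdd Θ' Θ

/-- The set `Θ H²`. -/
def innerMulH2 (Θ : ℂ → ℂ) : Set (ℂ → ℂ) :=
  {h | ∃ g, MemHardy2 g ∧ ∀ z ∈ disc, h z = Θ z * g z}

/-- Poisson extension of a boundary function (parametrized by `e^{it}`). -/
def poissonExt (u : ℝ → ℝ) (z : ℂ) : ℝ :=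
  (1 / (2 * Real.pi)) * ∫ t in (0:ℝ)..(2 * Real.pi),
    ((1 - ‖z‖ ^ 2) / ‖bpt t - z‖ ^ 2) * u t

/-- `|∇ P[u]|² P_μ`. -/
def gradDensity (μ : Measure ℂ) (u : ℝ → ℝ) (z : ℂ) : ℝ :=
  ‖fderiv ℝ (poissonExt u) z‖ ^ 2 * poissonMu μ z

/-- Membership in the harmonic Dirichlet space `D^h(μ)`. -/
def MemDh (μ : Measure ℂ) (u : ℝ → ℝ) : Prop :=
  IntegrableOn (fun t => (u t) ^ 2) (Set.Ioc 0 (2 * Real.pi)) volume ∧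
  IntegrableOn (gradDensity μ u) disc

/-- The squared norm of `D^h(μ)`. -/
def dhNormSq (μ : Measure ℂ) (u : ℝ → ℝ) : ℝ :=
  (1 / (2 * Real.pi)) * (∫ t in Set.Ioc 0 (2 * Real.pi), (u t) ^ 2) +
  (1 / Real.pi) * ∫ z in disc, gradDensity μ u z

/-- Relatively open subsets of the circle. -/
def RelOpen (U : Set ℂ) : Prop := ∃ V : Set ℂ, IsOpen V ∧ U = V ∩ circleT

/-- Capacity of a relatively open subset of the circle. -/
def capOpen (μ : Measure ℂ) (U : Set ℂ) : ℝ≥0∞ :=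
  ⨅ (u : ℝ → ℝ) (_ : MemDh μ u ∧ (∀ t, 0 ≤ u t) ∧
      ∀ᵐ t ∂θm, bpt t ∈ U → 1 ≤ u t),
    ENNReal.ofReal (dhNormSq μ u)

/-- The capacity `c_μ` of an arbitrary subset of the circle. -/
def cap (μ : Measure ℂ) (F : Set ℂ) : ℝ≥0∞ :=
  ⨅ (U : Set ℂ) (_ : RelOpen U ∧ F ⊆ U), capOpen μ U

/-- The (closed) support of a measure on `ℂ`. -/
def msupport (μ : Measure ℂ) : Set ℂ :=
  {x | ∀ r > 0, 0 < μ (Metric.ball x r)}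

/-- `M_μ(E)`: functions of `D(μ)` whose radial limits vanish `c_μ`-q.e. on `E`. -/
def Mspace (μ : Measure ℂ) (E : Set ℂ) : Set (ℂ → ℂ) :=
  {g | MemD μ g ∧ ∃ N : Set ℂ, cap μ N = 0 ∧ ∀ ζ ∈ E \ N, HasRadialLimitAt g ζ 0}

/-- Closed shift-invariant subspaces of `D(μ)` (closedness for the `D(μ)` norm). -/
structure ClosedInvSubspace (μ : Measure ℂ) (M : Set (ℂ → ℂ)) : Prop where
  subset : M ⊆ {f | MemD μ f}
  zero_mem : (fun _ => (0 : ℂ)) ∈ M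
  add_mem : ∀ f ∈ M, ∀ g ∈ M, (fun z => f z + g z) ∈ M
  smul_mem : ∀ (c : ℂ), ∀ f ∈ M, (fun z => c * f z) ∈ M
  shift_mem : ∀ f ∈ M, (fun z => z * f z) ∈ M
  closed : ∀ g, MemD μ g →
    (∀ ε > 0, ∃ h ∈ M, dNormSq μ (fun z => g z - h z) < ε) → g ∈ M

/-- The norm `‖f‖_{∞,μ}` of the Banach algebra `D(μ) ∩ H^∞`. -/
def algNorm (μ : Measure ℂ) (f : ℂ → ℂ) : ℝ :=
  supNorm f + Real.sqrt (dirichletIntegral μ f)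

/-- Membership in the Banach algebra `D(μ) ∩ H^∞`. -/
def MemA (μ : Measure ℂ) (f : ℂ → ℂ) : Prop := MemD μ f ∧ MemHinf f

/-- Closed ideals of `D(μ) ∩ H^∞`. -/
structure ClosedIdeal (μ : Measure ℂ) (J : Set (ℂ → ℂ)) : Prop where
  subset : J ⊆ {f | MemA μ f}
  zero_mem : (fun _ => (0 : ℂ)) ∈ J
  add_mem : ∀ f ∈ J, ∀ g ∈ J, (fun z => f z + g z) ∈ J
  mul_mem : ∀ f, MemA μ f → ∀ g ∈ J, (fun z => f z * g z) ∈ J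
  closed : ∀ g, MemA μ g →
    (∀ ε > 0, ∃ h ∈ J, algNorm μ (fun z => g z - h z) < ε) → g ∈ J

/-- A multiplier of `D(μ)`. -/
def IsMultiplier (μ : Measure ℂ) (φ : ℂ → ℂ) : Prop :=
  DifferentiableOn ℂ φ disc ∧ ∀ g, MemD μ g → MemD μ (fun z => φ z * g z)

/-- Distance between two subsets of `ℂ`. -/
def setDist (A B : Set ℂ) : ℝ :=
  sInf ((fun p : ℂ × ℂ => dist p.1 p.2) '' (A ×ˢ B))

/-! ### Poisson integrals on the unit circle -/

lemma continuous_bpt : Continuous bpt := by unfold bpt; fun_prop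

@[simp] lemma norm_bpt (t : ℝ) : ‖bpt t‖ = 1 := by
  rw [bpt, mul_comm, Complex.norm_exp_ofReal_mul_I]

lemma bpt_add (s t : ℝ) : bpt (s + t) = bpt s * bpt t := by
  simp [bpt, mul_add, Complex.exp_add]

lemma circleMap_eq_mul_bpt (r t : ℝ) : circleMap 0 r t = r * bpt t := by
  simp [circleMap, bpt, mul_comm]

/-- The harmonic measure of the unit disc seen from the real point `c`. -/
def poissonMeasure (c : ℝ) : Measure ℝ :=
  θm.withDensity fun t => ENNReal.ofReal ((2 * Real.pi)⁻¹ * ((1 - c ^ 2) / ‖bpt t - c‖ ^ 2))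

instance (c : ℝ) : SFinite (poissonMeasure c) := by
  unfold poissonMeasure θm; infer_instance

lemma integral_poissonMeasure {c : ℝ} (hc0 : 0 ≤ c) (hc : c < 1) {G : ℂ → ℂ}
    (hG : DiffContOnCl ℂ G (ball 0 1)) : ∫ t, G (bpt t) ∂poissonMeasure c = G c := by
  have hmem : (c : ℂ) ∈ ball (0 : ℂ) 1 := by simp [abs_of_nonneg hc0, hc]
  rw [← hG.circleAverage_poissonKernel_smul hmem, poissonMeasure,
    integral_withDensity_eq_integral_toReal_smul
      (by have := continuous_bpt.measurable; fun_prop) (by simp),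
    Real.circleAverage_def, intervalIntegral.integral_of_le Real.two_pi_pos.le,
    ← integral_smul]
  refine integral_congr_ae (Eventually.of_forall fun t => ?_)
  have h2 : 0 ≤ 1 - c ^ 2 := by nlinarith
  have : 0 ≤ (2 * Real.pi)⁻¹ * ((1 - c ^ 2) / ‖bpt t - c‖ ^ 2) := by
    have := Real.pi_pos; positivity
  simp only [ENNReal.toReal_ofReal this, Pi.smul_apply', poissonKernel_def, circleMap_eq_mul_bpt]
  simp [mul_assoc]

lemma enorm_sq_le_lintegral_poissonMeasure {c : ℝ} (hc0 : 0 ≤ c) (hc : c < 1) {G : ℂ → ℂ}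
    (hG : DiffContOnCl ℂ G (ball 0 1)) :
    ‖G c‖ₑ ^ 2 ≤ ∫⁻ t, ‖G (bpt t)‖ₑ ^ 2 ∂poissonMeasure c := by
  have h := integral_poissonMeasure hc0 hc (hG.smul hG)
  simp only [smul_eq_mul, ← pow_two] at h
  rw [← enorm_pow, ← h]
  exact (enorm_integral_le_lintegral_enorm _).trans_eq (lintegral_congr fun t => enorm_pow _ _)

/-- The Poisson kernel of the disc. -/
def diskKernel (ζ z : ℂ) : ℝ := (1 - ‖z‖ ^ 2) / ‖1 - (starRingEnd ℂ) ζ * z‖ ^ 2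

lemma one_sub_conj_mul_ne_zero {ζ z : ℂ} (hζ : ζ ∈ circleT) (hz : z ∈ disc) :
    1 - (starRingEnd ℂ) ζ * z ≠ 0 := by
  intro h
  have h1 : ‖(starRingEnd ℂ) ζ * z‖ = 1 := by rw [← sub_eq_zero.1 h, norm_one]
  simp only [circleT, disc, mem_sphere_zero_iff_norm, mem_ball_zero_iff] at hζ hz
  rw [norm_mul, RCLike.norm_conj, hζ, one_mul] at h1
  linarith

lemma diskKernel_pos {ζ z : ℂ} (hζ : ζ ∈ circleT) (hz : z ∈ disc) : 0 < diskKernel ζ z := by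
  have h1 := norm_pos_iff.2 (one_sub_conj_mul_ne_zero hζ hz)
  have h2 : 0 < 1 - ‖z‖ ^ 2 := by
    have := mem_ball_zero_iff.1 hz
    nlinarith [norm_nonneg z]
  unfold diskKernel; positivity

lemma diskKernel_le {ζ z : ℂ} (hζ : ζ ∈ circleT) (hz : z ∈ disc) :
    diskKernel ζ z ≤ (1 - ‖z‖ ^ 2) / (1 - ‖z‖) ^ 2 := by
  have hz' := mem_ball_zero_iff.1 hz
  have hζ' : ‖ζ‖ = 1 := by simpa [circleT] using hζ
  have h2 : 0 ≤ 1 - ‖z‖ ^ 2 := by nlinarith [norm_nonneg z]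
  have h3 : 1 - ‖z‖ ≤ ‖1 - (starRingEnd ℂ) ζ * z‖ := by
    have := norm_sub_norm_le 1 ((starRingEnd ℂ) ζ * z)
    simpa [hζ'] using this
  have h4 : 0 < 1 - ‖z‖ := by linarith
  unfold diskKernel
  gcongr

lemma re_cayley (w : ℂ) : ((1 + w) / (1 - w)).re = (1 - ‖w‖ ^ 2) / ‖1 - w‖ ^ 2 := by
  rw [div_re, ← add_div, normSq_eq_norm_sq, Complex.sq_norm w, normSq_apply]
  simp only [add_re, sub_re, add_im, sub_im, one_re, one_im]
  congr 1; ring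

lemma lintegral_diskKernel {c : ℝ} (hc0 : 0 ≤ c) (hc : c < 1) {ζ z : ℂ} (hζ : ζ ∈ circleT)
    (hz : z ∈ disc) :
    ∫⁻ t, ENNReal.ofReal (diskKernel ζ (z * (starRingEnd ℂ) (bpt t))) ∂poissonMeasure c =
      ENNReal.ofReal (diskKernel ζ (c * z)) := by
  have hz' := mem_ball_zero_iff.1 hz
  have hζ' : ‖ζ‖ = 1 := by simpa [circleT] using hζ
  set a : ℂ := ζ * (starRingEnd ℂ) z with ha
  have hna : ‖a‖ = ‖z‖ := by simp [a, hζ']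
  have key : ∀ w : ℂ, ((1 + a * w) / (1 - a * w)).re =
      diskKernel ζ (z * (starRingEnd ℂ) w) := by
    intro w
    rw [re_cayley, diskKernel]
    congr 2
    · simp [a, hζ']
    · rw [← RCLike.norm_conj (1 - a * w)]
      simp [a, mul_assoc]
  have hne : ∀ w ∈ closedBall (0 : ℂ) 1, 1 - a * w ≠ 0 := by
    intro w hw h
    have : ‖a * w‖ = 1 := by rw [← sub_eq_zero.1 h, norm_one]
    rw [norm_mul, hna] at this
    have hw' := mem_closedBall_zero_iff.1 hw
    nlinarith [norm_nonneg z, norm_nonneg w]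
  have hG : DiffContOnCl ℂ (fun w => (1 + a * w) / (1 - a * w)) (ball 0 1) := by
    refine DifferentiableOn.diffContOnCl ?_
    rw [closure_ball _ one_ne_zero]
    exact DifferentiableOn.div (by fun_prop) (by fun_prop) hne
  have h := integral_poissonMeasure hc0 hc hG
  have hcz : (c : ℂ) * z ∈ disc := by
    simp only [disc, mem_ball_zero_iff, norm_mul, norm_real, Real.norm_eq_abs, abs_of_nonneg hc0]
    nlinarith [norm_nonneg z]
  have hre : ((1 + a * c) / (1 - a * c)).re = diskKernel ζ (c * z) := by
    rw [key, conj_ofReal, mul_comm]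
  have hint : Integrable (fun t => (1 + a * bpt t) / (1 - a * bpt t)) (poissonMeasure c) := by
    by_contra hni
    rw [integral_undef hni] at h
    have := diskKernel_pos hζ hcz
    rw [← hre, ← h] at this
    simp at this
  rw [← hre, ← h, ← RCLike.re_eq_complex_re, ← integral_re hint,
    ofReal_integral_eq_lintegral_ofReal hint.re]
  · simp only [RCLike.re_eq_complex_re, key]
  · refine Eventually.of_forall fun t => ?_
    simp only [RCLike.re_eq_complex_re, key]
    refine (diskKernel_pos hζ ?_).le
    simpa [disc] using hz'

/-! ### Weighted area integrals -/

/-- The Poisson integral of `μ` with values in `[0, ∞]`. -/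
def weight (μ : Measure ℂ) (z : ℂ) : ℝ≥0∞ := ∫⁻ ζ, ENNReal.ofReal (diskKernel ζ z) ∂μ

lemma measurable_diskKernel : Measurable fun p : ℂ × ℂ => diskKernel p.1 p.2 := by
  unfold diskKernel; fun_prop

lemma measurable_weight (μ : Measure ℂ) [SFinite μ] : Measurable (weight μ) := by
  have : Measurable fun p : ℂ × ℂ => ENNReal.ofReal (diskKernel p.2 p.1) :=
    (measurable_diskKernel.comp measurable_swap).ennreal_ofReal
  exact this.lintegral_prod_right'

lemma OnCircle.ae_mem {μ : Measure ℂ} (hμ : OnCircle μ) : ∀ᵐ ζ ∂μ, ζ ∈ circleT := hμ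

lemma weight_eq {μ : Measure ℂ} [IsFiniteMeasure μ] (hμ : OnCircle μ) {z : ℂ} (hz : z ∈ disc) :
    weight μ z = ENNReal.ofReal (poissonMu μ z) := by
  have hm : Measurable fun ζ => diskKernel ζ z := by unfold diskKernel; fun_prop
  have hpos : ∀ᵐ ζ ∂μ, 0 ≤ diskKernel ζ z := hμ.ae_mem.mono fun ζ hζ => (diskKernel_pos hζ hz).le
  have hint : Integrable (fun ζ => diskKernel ζ z) μ := by
    refine Integrable.of_bound hm.aestronglyMeasurable ((1 - ‖z‖ ^ 2) / (1 - ‖z‖) ^ 2) ?_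
    filter_upwards [hμ.ae_mem, hpos] with ζ hζ h
    rw [Real.norm_of_nonneg h]
    exact diskKernel_le hζ hz
  exact (ofReal_integral_eq_lintegral_ofReal hint hpos).symm

lemma lintegral_weight {μ : Measure ℂ} [SFinite μ] (hμ : OnCircle μ) {c : ℝ} (hc0 : 0 ≤ c)
    (hc : c < 1) {z : ℂ} (hz : z ∈ disc) :
    ∫⁻ t, weight μ (z * (starRingEnd ℂ) (bpt t)) ∂poissonMeasure c = weight μ (c * z) := by
  unfold weight
  rw [lintegral_lintegral_swap]
  · refine lintegral_congr_ae ?_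
    filter_upwards [hμ.ae_mem] with ζ hζ
    exact lintegral_diskKernel hc0 hc hζ hz
  · have h1 := continuous_bpt.measurable
    have : Measurable fun p : ℝ × ℂ => (p.2, z * (starRingEnd ℂ) (bpt p.1)) := by fun_prop
    exact (measurable_diskKernel.comp this).ennreal_ofReal.aemeasurable

lemma measurableSet_disc : MeasurableSet disc := measurableSet_ball

lemma lintegral_disc_rotate (t : ℝ) (φ : ℂ → ℝ≥0∞) :
    ∫⁻ z in disc, φ (z * bpt t) = ∫⁻ z in disc, φ z := by
  have hu : bpt t = (Circle.exp t : ℂ) := by simp [bpt, Circle.coe_exp, mul_comm]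
  have h := (rotation (Circle.exp t)).measurePreserving.setLIntegral_comp_preimage_emb
    (rotation (Circle.exp t)).toMeasurableEquiv.measurableEmbedding φ disc
  have hp : rotation (Circle.exp t) ⁻¹' disc = disc := by
    ext z
    rw [mem_preimage, disc, mem_ball_zero_iff, mem_ball_zero_iff, LinearIsometryEquiv.norm_map]
  rw [hp] at h
  simpa [rotation_apply, hu, mul_comm] using h

lemma lintegral_disc_dilate_le {c : ℝ} (hc0 : 0 < c) (hc : c ≤ 1) {φ : ℂ → ℝ≥0∞}
    (hφ : Measurable φ) :
    ∫⁻ z in disc, φ (c * z) ≤ ENNReal.ofReal ((c ^ 2)⁻¹) * ∫⁻ z in disc, φ z := by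
  have h := Measure.map_addHaar_smul (volume : Measure ℂ) hc0.ne'
  rw [Complex.finrank_real_complex, abs_of_nonneg (by positivity)] at h
  rw [← lintegral_indicator measurableSet_disc, ← lintegral_indicator measurableSet_disc,
    ← smul_eq_mul (ENNReal.ofReal _), ← lintegral_smul_measure, ← h,
    lintegral_map (hφ.indicator measurableSet_disc) (measurable_const_smul c)]
  refine lintegral_mono fun z => ?_
  by_cases hz : z ∈ disc
  · have : (c : ℂ) * z ∈ disc := by
      simp only [disc, mem_ball_zero_iff, norm_mul, norm_real, Real.norm_of_nonneg hc0.le] at hz ⊢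
      nlinarith [norm_nonneg z]
    simp [indicator_of_mem hz, indicator_of_mem this]
  · simp [indicator_of_notMem hz]

lemma ofReal_mul_mem_disc {a : ℝ} (ha0 : 0 ≤ a) (ha : a ≤ 1) {z : ℂ} (hz : z ∈ disc) :
    (a : ℂ) * z ∈ disc := by
  simp only [disc, mem_ball_zero_iff, norm_mul, norm_real, Real.norm_of_nonneg ha0] at hz ⊢
  nlinarith [norm_nonneg z]

lemma diffContOnCl_comp_mul {F : ℂ → ℂ} (hF : DifferentiableOn ℂ F disc) {z : ℂ}
    (hz : z ∈ disc) : DiffContOnCl ℂ (fun w => F (z * w)) (ball 0 1) := by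
  refine DifferentiableOn.diffContOnCl ?_
  rw [closure_ball _ one_ne_zero]
  refine hF.comp (by fun_prop) fun w hw => ?_
  simp only [disc, mem_ball_zero_iff, mem_closedBall_zero_iff, norm_mul] at hz hw ⊢
  nlinarith [norm_nonneg z, norm_nonneg w]

lemma lintegral_weight_shift {μ : Measure ℂ} [SFinite μ] (hμ : OnCircle μ) {F : ℂ → ℂ}
    (hFm : Measurable F) (hF : DifferentiableOn ℂ F disc) {a c : ℝ} (ha0 : 0 ≤ a) (ha : a ≤ 1)
    (hc0 : 0 ≤ c) (hc : c < 1) :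
    ∫⁻ z in disc, ‖F (a * z * c)‖ₑ ^ 2 * weight μ z ≤
      ∫⁻ z in disc, ‖F (a * z)‖ₑ ^ 2 * weight μ (c * z) := by
  have hb := continuous_bpt.measurable
  have hW := measurable_weight μ
  calc ∫⁻ z in disc, ‖F (a * z * c)‖ₑ ^ 2 * weight μ z
      ≤ ∫⁻ z in disc, ∫⁻ t, ‖F (a * z * bpt t)‖ₑ ^ 2 * weight μ z ∂poissonMeasure c := by
        refine setLIntegral_mono' measurableSet_disc fun z hz => ?_
        rw [lintegral_mul_const _ (by fun_prop)]
        gcongr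
        exact enorm_sq_le_lintegral_poissonMeasure hc0 hc
          (diffContOnCl_comp_mul hF (ofReal_mul_mem_disc ha0 ha hz))
    _ = ∫⁻ t, (∫⁻ z in disc, ‖F (a * z * bpt t)‖ₑ ^ 2 * weight μ z) ∂poissonMeasure c := by
        rw [lintegral_lintegral_swap]
        exact Measurable.aemeasurable (by fun_prop)
    _ = ∫⁻ t, (∫⁻ z in disc, ‖F (a * z)‖ₑ ^ 2 * weight μ (z * (starRingEnd ℂ) (bpt t)))
          ∂poissonMeasure c := by
        refine lintegral_congr fun t => ?_
        rw [← lintegral_disc_rotate t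
          (fun z => ‖F (a * z)‖ₑ ^ 2 * weight μ (z * (starRingEnd ℂ) (bpt t)))]
        refine lintegral_congr fun z => ?_
        rw [mul_assoc z, mul_conj, normSq_eq_norm_sq, norm_bpt, mul_assoc]
        simp
    _ = ∫⁻ z in disc, ∫⁻ t, ‖F (a * z)‖ₑ ^ 2 * weight μ (z * (starRingEnd ℂ) (bpt t))
          ∂poissonMeasure c := by
        rw [lintegral_lintegral_swap]
        exact Measurable.aemeasurable (by fun_prop)
    _ = ∫⁻ z in disc, ‖F (a * z)‖ₑ ^ 2 * weight μ (c * z) := by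
        refine setLIntegral_congr_fun measurableSet_disc fun z hz => ?_
        rw [lintegral_const_mul _ (by fun_prop), lintegral_weight hμ hc0 hc hz]

lemma lintegral_weight_dilate {μ : Measure ℂ} [SFinite μ] (hμ : OnCircle μ) {F : ℂ → ℂ}
    (hFm : Measurable F) (hF : DifferentiableOn ℂ F disc) {s : ℝ} (hs0 : 0 < s) (hs : s < 1) :
    ∫⁻ z in disc, ‖F (s * z)‖ₑ ^ 2 * weight μ z ≤
      ENNReal.ofReal s⁻¹ * ∫⁻ z in disc, ‖F z‖ₑ ^ 2 * weight μ z := by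
  have hW := measurable_weight μ
  have h1 : √s < 1 := by rw [Real.sqrt_lt' one_pos]; simpa
  have h := lintegral_weight_shift hμ hFm hF (Real.sqrt_nonneg s) h1.le (Real.sqrt_nonneg s) h1
  have h2 := lintegral_disc_dilate_le (Real.sqrt_pos.2 hs0) h1.le
    (φ := fun z => ‖F z‖ₑ ^ 2 * weight μ z) (by fun_prop)
  rw [Real.sq_sqrt hs0.le] at h2
  refine le_trans (le_of_eq (lintegral_congr fun z => ?_)) (h.trans h2)
  rw [mul_right_comm, ← ofReal_mul, Real.mul_self_sqrt hs0.le]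

lemma lintegral_weight_lt_top {μ : Measure ℂ} [IsFiniteMeasure μ] (hμ : OnCircle μ) :
    ∫⁻ z in disc, weight μ z < ∞ := by
  have h := lintegral_weight_shift hμ (F := fun _ => 1) (by fun_prop) (by fun_prop)
    zero_le_one le_rfl le_rfl zero_lt_one
  have h0 : weight μ 0 = μ univ := by simp [weight, diskKernel]
  simp only [enorm_one, one_pow, one_mul, ofReal_zero, zero_mul, h0, lintegral_const,
    Measure.restrict_apply_univ] at h
  refine h.trans_lt (ENNReal.mul_lt_top (measure_lt_top _ _) ?_)
  exact measure_ball_lt_top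

/-! ### The energy of `D(μ)` with values in `[0, ∞]` -/

/-- The integral of `|f|²` over the circle of radius `r`. -/
def meanSq (f : ℂ → ℂ) (r : ℝ) : ℝ≥0∞ := ∫⁻ t, ‖f (r * bpt t)‖ₑ ^ 2 ∂θm

/-- The squared Hardy norm up to normalization, with values in `[0, ∞]`. -/
def hardyEnergy (f : ℂ → ℂ) : ℝ≥0∞ := ⨆ r : Ioo (0 : ℝ) 1, meanSq f r

/-- The Dirichlet integral up to normalization, with values in `[0, ∞]`. -/
def dirichletEnergy (μ : Measure ℂ) (f : ℂ → ℂ) : ℝ≥0∞ :=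
  ∫⁻ z in disc, ‖deriv f z‖ₑ ^ 2 * weight μ z

/-- The squared norm of `D(μ)` up to normalization, with values in `[0, ∞]`. -/
def energy (μ : Measure ℂ) (f : ℂ → ℂ) : ℝ≥0∞ := hardyEnergy f + dirichletEnergy μ f

lemma isOpen_disc : IsOpen disc := isOpen_ball

lemma mul_bpt_mem_disc {r : ℝ} (hr0 : 0 ≤ r) (hr : r < 1) (t : ℝ) : (r : ℂ) * bpt t ∈ disc := by
  simpa [disc, abs_of_nonneg hr0] using hr

lemma continuous_comp_circle {f : ℂ → ℂ} (hf : DifferentiableOn ℂ f disc) {r : ℝ} (hr0 : 0 ≤ r)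
    (hr : r < 1) : Continuous fun t => f (r * bpt t) :=
  hf.continuousOn.comp_continuous (by have := continuous_bpt; fun_prop) (mul_bpt_mem_disc hr0 hr)

lemma lintegral_θm_eq {v : ℝ → ℝ} (hv : Continuous v) (h0 : ∀ t, 0 ≤ v t) :
    ∫⁻ t, ENNReal.ofReal (v t) ∂θm = ENNReal.ofReal (∫ t in (0 : ℝ)..(2 * Real.pi), v t) := by
  rw [intervalIntegral.integral_of_le Real.two_pi_pos.le,
    ofReal_integral_eq_lintegral_ofReal _ (Eventually.of_forall h0)]
  · rfl
  · exact (hv.integrableOn_Icc (a := 0) (b := 2 * Real.pi)).mono_set Ioc_subset_Icc_self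

lemma enorm_sq_eq (z : ℂ) : ‖z‖ₑ ^ 2 = ENNReal.ofReal (‖z‖ ^ 2) := by
  rw [ENNReal.ofReal_pow (norm_nonneg z), ofReal_norm]

lemma meanSq_eq {f : ℂ → ℂ} (hf : DifferentiableOn ℂ f disc) {r : ℝ} (hr0 : 0 ≤ r)
    (hr : r < 1) :
    meanSq f r =
      ENNReal.ofReal (∫ t in (0 : ℝ)..(2 * Real.pi), ‖f (r * bpt t)‖ ^ 2) := by
  have := continuous_comp_circle hf hr0 hr
  simp only [meanSq, enorm_sq_eq]
  exact lintegral_θm_eq (this.norm.pow 2) fun t => by positivity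

lemma lintegral_circle_rotate {f : ℂ → ℂ} (hf : DifferentiableOn ℂ f disc) {r : ℝ} (hr0 : 0 ≤ r)
    (hr : r < 1) (s : ℝ) : ∫⁻ t, ‖f (r * bpt t * bpt s)‖ₑ ^ 2 ∂θm = meanSq f r := by
  have hc := continuous_comp_circle hf hr0 hr
  simp only [meanSq_eq hf hr0 hr, enorm_sq_eq, mul_assoc, ← bpt_add]
  rw [lintegral_θm_eq (v := fun t => ‖f (r * bpt (t + s))‖ ^ 2)
    ((hc.comp (continuous_add_const s)).norm.pow 2) fun t => by positivity]
  congr 1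
  have hper : Function.Periodic (fun t => ‖f (r * bpt t)‖ ^ 2) (2 * Real.pi) := fun t => by
    have : bpt (2 * Real.pi) = 1 := by
      simpa [bpt, mul_comm] using Complex.exp_two_pi_mul_I
    simp [bpt_add, this]
  rw [intervalIntegral.integral_comp_add_right (fun t => ‖f (r * bpt t)‖ ^ 2)]
  simpa [add_comm] using hper.intervalIntegral_add_eq s 0

instance : SFinite θm := by unfold θm; infer_instance

lemma poissonMeasure_univ {c : ℝ} (hc0 : 0 ≤ c) (hc : c < 1) : poissonMeasure c univ = 1 := by
  have h := integral_poissonMeasure hc0 hc (G := fun _ => 1) diffContOnCl_const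
  rw [integral_const, Complex.real_smul, mul_one, ← ofReal_one, ofReal_inj, measureReal_def,
    ENNReal.toReal_eq_one_iff] at h
  exact h

lemma meanSq_mul_le {f : ℂ → ℂ} (hf : DifferentiableOn ℂ f disc) {r c : ℝ} (hr0 : 0 ≤ r)
    (hr : r < 1) (hc0 : 0 ≤ c) (hc : c < 1) : meanSq f (r * c) ≤ meanSq f r := by
  calc meanSq f (r * c)
      ≤ ∫⁻ t, ∫⁻ s, ‖f (r * bpt t * bpt s)‖ₑ ^ 2 ∂poissonMeasure c ∂θm := by
        refine lintegral_mono fun t => ?_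
        have := enorm_sq_le_lintegral_poissonMeasure hc0 hc
          (diffContOnCl_comp_mul hf (mul_bpt_mem_disc hr0 hr t))
        simpa [mul_right_comm] using this
    _ = ∫⁻ s, ∫⁻ t, ‖f (r * bpt t * bpt s)‖ₑ ^ 2 ∂θm ∂poissonMeasure c := by
        refine lintegral_lintegral_swap ?_
        have h1 := continuous_comp_circle hf hr0 hr
        have h2 : Measurable fun p : ℝ × ℝ => ‖f (r * bpt p.1 * bpt p.2)‖ₑ ^ 2 := by
          simp only [mul_assoc, ← bpt_add]
          exact (h1.comp continuous_add).enorm.measurable.pow_const 2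
        exact h2.aemeasurable
    _ = meanSq f r := by
        simp [lintegral_circle_rotate hf hr0 hr, poissonMeasure_univ hc0 hc]

lemma meanSq_mono {f : ℂ → ℂ} (hf : DifferentiableOn ℂ f disc) :
    Monotone fun r : Ioo (0 : ℝ) 1 => meanSq f r := by
  intro a b hab
  rcases hab.eq_or_lt with h | h
  · rw [h]
  · have hb := b.2.1
    have : (a : ℝ) = b * (a / b) := by field_simp
    beta_reduce
    rw [this]
    exact meanSq_mul_le hf hb.le b.2.2 (div_nonneg a.2.1.le hb.le)
      ((div_lt_one hb).2 h)

lemma enorm_parallelogram (a b : ℂ) :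
    ‖a + b‖ₑ ^ 2 + ‖a - b‖ₑ ^ 2 = 2 * ‖a‖ₑ ^ 2 + 2 * ‖b‖ₑ ^ 2 := by
  simp only [enorm_sq_eq]
  rw [← ENNReal.ofReal_add (by positivity) (by positivity), ← ENNReal.ofReal_ofNat 2,
    ← ENNReal.ofReal_mul zero_le_two, ← ENNReal.ofReal_mul zero_le_two,
    ← ENNReal.ofReal_add (by positivity) (by positivity)]
  congr 1
  have := parallelogram_law_with_norm ℝ a b
  linarith

lemma meanSq_parallelogram {f g : ℂ → ℂ} (hf : DifferentiableOn ℂ f disc)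
    (hg : DifferentiableOn ℂ g disc) (r : Ioo (0 : ℝ) 1) :
    meanSq (f + g) r + meanSq (f - g) r = 2 * meanSq f r + 2 * meanSq g r := by
  have h1 := continuous_comp_circle hf r.2.1.le r.2.2
  have h2 := continuous_comp_circle hg r.2.1.le r.2.2
  have h3 := h1.enorm.measurable.pow_const 2
  have h4 := h2.enorm.measurable.pow_const 2
  have h5 : Measurable fun t => ‖(f + g) (r * bpt t)‖ₑ ^ 2 :=
    (h1.add h2).enorm.measurable.pow_const 2
  unfold meanSq
  rw [← lintegral_const_mul _ h3, ← lintegral_const_mul _ h4,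
    ← lintegral_add_left (h3.const_mul 2),
    ← lintegral_add_left h5]
  exact lintegral_congr fun t => enorm_parallelogram _ _

lemma hardyEnergy_parallelogram {f g : ℂ → ℂ} (hf : DifferentiableOn ℂ f disc)
    (hg : DifferentiableOn ℂ g disc) :
    hardyEnergy (f + g) + hardyEnergy (f - g) = 2 * hardyEnergy f + 2 * hardyEnergy g := by
  unfold hardyEnergy
  rw [ENNReal.mul_iSup, ENNReal.mul_iSup,
    ENNReal.iSup_add_iSup_of_monotone (meanSq_mono (hf.add hg)) (meanSq_mono (hf.sub hg)),
    ENNReal.iSup_add_iSup_of_monotone ((meanSq_mono hf).const_mul' 2)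
      ((meanSq_mono hg).const_mul' 2)]
  exact iSup_congr fun r => meanSq_parallelogram hf hg r

lemma dirichletEnergy_parallelogram (μ : Measure ℂ) [SFinite μ] {f g : ℂ → ℂ}
    (hf : DifferentiableOn ℂ f disc) (hg : DifferentiableOn ℂ g disc) :
    dirichletEnergy μ (f + g) + dirichletEnergy μ (f - g) =
      2 * dirichletEnergy μ f + 2 * dirichletEnergy μ g := by
  have hW := measurable_weight μ
  have h1 := measurable_deriv f
  have h2 := measurable_deriv g
  have h3 := measurable_deriv (f + g)
  unfold dirichletEnergy
  rw [← lintegral_const_mul _ (by fun_prop), ← lintegral_const_mul _ (by fun_prop),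
    ← lintegral_add_left (by fun_prop), ← lintegral_add_left (by fun_prop)]
  refine setLIntegral_congr_fun measurableSet_disc fun z hz => ?_
  have h4 := hf.differentiableAt (isOpen_disc.mem_nhds hz)
  have h5 := hg.differentiableAt (isOpen_disc.mem_nhds hz)
  rw [deriv_add h4 h5, deriv_sub h4 h5, ← add_mul, enorm_parallelogram]
  ring

lemma energy_parallelogram (μ : Measure ℂ) [SFinite μ] {f g : ℂ → ℂ}
    (hf : DifferentiableOn ℂ f disc) (hg : DifferentiableOn ℂ g disc) :
    energy μ (f + g) + energy μ (f - g) = 2 * energy μ f + 2 * energy μ g := by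
  have h1 := hardyEnergy_parallelogram hf hg
  have h2 := dirichletEnergy_parallelogram μ hf hg
  unfold energy
  rw [add_add_add_comm, h1, h2]
  ring

lemma energy_add_le (μ : Measure ℂ) [SFinite μ] {f g : ℂ → ℂ}
    (hf : DifferentiableOn ℂ f disc) (hg : DifferentiableOn ℂ g disc) :
    energy μ (f + g) ≤ 2 * energy μ f + 2 * energy μ g :=
  energy_parallelogram μ hf hg ▸ le_self_add

lemma energy_const_mul (μ : Measure ℂ) [SFinite μ] (c : ℂ) (f : ℂ → ℂ) :
    energy μ (fun z => c * f z) = ‖c‖ₑ ^ 2 * energy μ f := by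
  have hfin : ‖c‖ₑ ^ 2 ≠ ∞ := by simp
  simp only [energy, hardyEnergy, dirichletEnergy, meanSq, deriv_const_mul_field, enorm_mul,
    mul_pow, mul_add, ENNReal.mul_iSup, mul_assoc, lintegral_const_mul' _ _ hfin]

lemma hardyEnergy_le {f : ℂ → ℂ} (hf : MemHardy2 f) :
    hardyEnergy f ≤ ENNReal.ofReal (2 * Real.pi * hardyNormSq f) := by
  refine iSup_le fun r => ?_
  rw [meanSq_eq hf.1 r.2.1.le r.2.2]
  refine ENNReal.ofReal_le_ofReal ?_
  rw [← div_le_iff₀' Real.two_pi_pos, div_eq_inv_mul, ← one_div]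
  exact le_csSup hf.2 ⟨r, r.2.1, r.2.2, rfl⟩

lemma hardySet_le {f : ℂ → ℂ} (hf : DifferentiableOn ℂ f disc) (h : hardyEnergy f ≠ ∞) {x : ℝ}
    (hx : x ∈ hardySet f) : x ≤ (hardyEnergy f).toReal := by
  obtain ⟨r, hr0, hr, rfl⟩ := hx
  have h1 : meanSq f r ≤ hardyEnergy f :=
    le_iSup (fun r : Ioo (0 : ℝ) 1 => meanSq f r) ⟨r, hr0, hr⟩
  have h2 : 0 ≤ ∫ t in (0 : ℝ)..(2 * Real.pi), ‖f (r * bpt t)‖ ^ 2 :=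
    intervalIntegral.integral_nonneg Real.two_pi_pos.le fun t _ => by positivity
  rw [meanSq_eq hf hr0.le hr, ENNReal.ofReal_le_iff_le_toReal h] at h1
  refine le_trans (mul_le_of_le_one_left h2 ?_) h1
  rw [div_le_one Real.two_pi_pos]
  linarith [Real.pi_gt_three]

lemma memHardy2_of_hardyEnergy {f : ℂ → ℂ} (hf : DifferentiableOn ℂ f disc)
    (h : hardyEnergy f ≠ ∞) : MemHardy2 f :=
  ⟨hf, (hardyEnergy f).toReal, fun _ hx => hardySet_le hf h hx⟩

lemma hardyNormSq_le {f : ℂ → ℂ} (hf : DifferentiableOn ℂ f disc) (h : hardyEnergy f ≠ ∞) :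
    hardyNormSq f ≤ (hardyEnergy f).toReal :=
  csSup_le ⟨_, 1 / 2, by norm_num, by norm_num, rfl⟩ fun _ hx => hardySet_le hf h hx

lemma hardyNormSq_nonneg (f : ℂ → ℂ) : 0 ≤ hardyNormSq f := by
  refine Real.sSup_nonneg ?_
  rintro x ⟨r, -, -, rfl⟩
  have := intervalIntegral.integral_nonneg (μ := volume) Real.two_pi_pos.le
    fun (t : ℝ) _ => sq_nonneg ‖f (r * bpt t)‖
  have := Real.pi_pos
  positivity

lemma poissonMu_nonneg {μ : Measure ℂ} (hμ : OnCircle μ) {z : ℂ} (hz : z ∈ disc) :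
    0 ≤ poissonMu μ z :=
  integral_nonneg_of_ae (hμ.ae_mem.mono fun _ hζ => (diskKernel_pos hζ hz).le)

lemma measurable_poissonMu (μ : Measure ℂ) [SFinite μ] : Measurable (poissonMu μ) := by
  have : StronglyMeasurable fun p : ℂ × ℂ => diskKernel p.2 p.1 :=
    (measurable_diskKernel.comp measurable_swap).stronglyMeasurable
  exact this.integral_prod_right'.measurable

lemma lintegral_enorm_dirichletDensity {μ : Measure ℂ} [IsFiniteMeasure μ] (hμ : OnCircle μ)
    (f : ℂ → ℂ) : ∫⁻ z in disc, ‖dirichletDensity μ f z‖ₑ = dirichletEnergy μ f := by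
  refine setLIntegral_congr_fun measurableSet_disc fun z hz => ?_
  rw [weight_eq hμ hz, dirichletDensity, enorm_mul, enorm_pow, enorm_norm,
    Real.enorm_of_nonneg (poissonMu_nonneg hμ hz)]

lemma integrableOn_dirichletDensity_iff {μ : Measure ℂ} [IsFiniteMeasure μ] (hμ : OnCircle μ)
    (f : ℂ → ℂ) : IntegrableOn (dirichletDensity μ f) disc ↔ dirichletEnergy μ f ≠ ∞ := by
  have h1 := measurable_deriv f
  have h2 := measurable_poissonMu μ
  have : Measurable (dirichletDensity μ f) := by unfold dirichletDensity; fun_prop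
  rw [IntegrableOn, Integrable, and_iff_right this.aestronglyMeasurable, HasFiniteIntegral,
    lintegral_enorm_dirichletDensity hμ, lt_top_iff_ne_top]

lemma dirichletIntegral_eq {μ : Measure ℂ} [IsFiniteMeasure μ] (hμ : OnCircle μ) {f : ℂ → ℂ}
    (hf : dirichletEnergy μ f ≠ ∞) :
    dirichletIntegral μ f = 1 / Real.pi * (dirichletEnergy μ f).toReal := by
  have h := (integrableOn_dirichletDensity_iff hμ f).2 hf
  rw [dirichletIntegral, ← lintegral_enorm_dirichletDensity hμ,
    ← integral_norm_eq_lintegral_enorm h.aestronglyMeasurable]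
  congr 1
  refine setIntegral_congr_fun measurableSet_disc fun z hz => ?_
  refine (Real.norm_of_nonneg ?_).symm
  exact mul_nonneg (sq_nonneg _) (poissonMu_nonneg hμ hz)

lemma memD_iff {μ : Measure ℂ} [IsFiniteMeasure μ] (hμ : OnCircle μ) {f : ℂ → ℂ} :
    MemD μ f ↔ DifferentiableOn ℂ f disc ∧ energy μ f ≠ ∞ := by
  rw [MemD, integrableOn_dirichletDensity_iff hμ, energy, ENNReal.add_ne_top]
  constructor
  · exact fun h => ⟨h.1.1, ((hardyEnergy_le h.1).trans_lt ENNReal.ofReal_lt_top).ne, h.2⟩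
  · exact fun h => ⟨memHardy2_of_hardyEnergy h.1 h.2.1, h.2.2⟩

lemma dNormSq_le {μ : Measure ℂ} [IsFiniteMeasure μ] (hμ : OnCircle μ) {f : ℂ → ℂ}
    (hf : MemD μ f) : dNormSq μ f ≤ (energy μ f).toReal := by
  obtain ⟨hd, he⟩ := (memD_iff hμ).1 hf
  obtain ⟨h1, h2⟩ := ENNReal.add_ne_top.1 he
  rw [energy, ENNReal.toReal_add h1 h2, dNormSq, dirichletIntegral_eq hμ h2]
  refine add_le_add (hardyNormSq_le hd h1) (mul_le_of_le_one_left ENNReal.toReal_nonneg ?_)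
  rw [div_le_one Real.pi_pos]
  linarith [Real.pi_gt_three]

lemma energy_le_dNormSq {μ : Measure ℂ} [IsFiniteMeasure μ] (hμ : OnCircle μ) {f : ℂ → ℂ}
    (hf : MemD μ f) : energy μ f ≤ ENNReal.ofReal (2 * Real.pi * dNormSq μ f) := by
  have h2 := (integrableOn_dirichletDensity_iff hμ f).1 hf.2
  have h3 := Real.pi_pos
  have h4 := hardyNormSq_nonneg f
  rw [energy, dNormSq, dirichletIntegral_eq hμ h2, mul_add,
    ENNReal.ofReal_add (by positivity) (by positivity)]
  refine add_le_add (hardyEnergy_le hf.1) ?_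
  rw [← ENNReal.ofReal_toReal h2]
  refine ENNReal.ofReal_le_ofReal ?_
  rw [ENNReal.toReal_ofReal ENNReal.toReal_nonneg]
  have : 2 * Real.pi * (1 / Real.pi * (dirichletEnergy μ f).toReal) =
    2 * (dirichletEnergy μ f).toReal := by field_simp
  rw [this]
  linarith [ENNReal.toReal_nonneg (a := dirichletEnergy μ f)]

/-! ### Bounds for products -/

lemma enorm_add_sq_le (a b : ℂ) : ‖a + b‖ₑ ^ 2 ≤ 2 * ‖a‖ₑ ^ 2 + 2 * ‖b‖ₑ ^ 2 :=
  enorm_parallelogram a b ▸ le_self_add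

lemma hardyEnergy_mul_le {φ g : ℂ → ℂ} {C : ℝ≥0∞} (hC : ∀ z ∈ disc, ‖φ z‖ₑ ≤ C) (hCt : C ≠ ∞) :
    hardyEnergy (fun z => φ z * g z) ≤ C ^ 2 * hardyEnergy g := by
  refine iSup_le fun r => ?_
  refine le_trans ?_ (mul_right_mono (le_iSup (fun r : Ioo (0 : ℝ) 1 => meanSq g r) r))
  beta_reduce
  rw [meanSq, meanSq, ← lintegral_const_mul' _ _ (by simp [hCt])]
  refine lintegral_mono fun t => ?_
  rw [enorm_mul, mul_pow]
  gcongr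
  exact hC _ (mul_bpt_mem_disc r.2.1.le r.2.2 t)

lemma energy_mul_le {μ : Measure ℂ} [SFinite μ] {φ g : ℂ → ℂ} (hφ : DifferentiableOn ℂ φ disc)
    (hg : DifferentiableOn ℂ g disc) {C : ℝ≥0∞} (hC : ∀ z ∈ disc, ‖φ z‖ₑ ≤ C)
    (hC' : ∀ z ∈ disc, ‖deriv φ z‖ₑ ≤ C) (hCt : C ≠ ∞) :
    energy μ (fun z => φ z * g z) ≤
      C ^ 2 * (2 * energy μ g + 2 * ∫⁻ z in disc, ‖g z‖ₑ ^ 2 * weight μ z) := by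
  have hW := measurable_weight μ
  have hm := measurable_deriv g
  have hCt2 : C ^ 2 ≠ ∞ := by simp [hCt]
  have hD : dirichletEnergy μ (fun z => φ z * g z) ≤
      C ^ 2 * (2 * dirichletEnergy μ g + 2 * ∫⁻ z in disc, ‖g z‖ₑ ^ 2 * weight μ z) := by
    unfold dirichletEnergy
    rw [← lintegral_const_mul' _ _ (by simp), ← lintegral_const_mul' _ _ (by simp),
      ← lintegral_add_left (by fun_prop), ← lintegral_const_mul' _ _ hCt2]
    refine setLIntegral_mono' measurableSet_disc fun z hz => ?_
    have h4 := hφ.differentiableAt (isOpen_disc.mem_nhds hz)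
    have h5 := hg.differentiableAt (isOpen_disc.mem_nhds hz)
    rw [deriv_fun_mul h4 h5]
    calc ‖deriv φ z * g z + φ z * deriv g z‖ₑ ^ 2 * weight μ z
        ≤ (2 * ‖deriv φ z * g z‖ₑ ^ 2 + 2 * ‖φ z * deriv g z‖ₑ ^ 2) * weight μ z := by
          gcongr; exact enorm_add_sq_le _ _
      _ ≤ (2 * (C * ‖g z‖ₑ) ^ 2 + 2 * (C * ‖deriv g z‖ₑ) ^ 2) * weight μ z := by
          rw [enorm_mul, enorm_mul]
          gcongr
          · exact hC' z hz
          · exact hC z hz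
      _ = _ := by ring
  have hH := hardyEnergy_mul_le (g := g) hC hCt
  calc energy μ (fun z => φ z * g z) ≤ C ^ 2 * hardyEnergy g + C ^ 2 *
        (2 * dirichletEnergy μ g + 2 * ∫⁻ z in disc, ‖g z‖ₑ ^ 2 * weight μ z) :=
      add_le_add hH hD
    _ = C ^ 2 * (hardyEnergy g + 2 * dirichletEnergy μ g +
        2 * ∫⁻ z in disc, ‖g z‖ₑ ^ 2 * weight μ z) := by ring
    _ ≤ C ^ 2 * (2 * energy μ g + 2 * ∫⁻ z in disc, ‖g z‖ₑ ^ 2 * weight μ z) := by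
      rw [energy, mul_add 2 (hardyEnergy g)]
      gcongr
      exact le_mul_of_one_le_left' (by norm_num)

lemma sq_lintegral_le {α : Type*} [MeasurableSpace α] (ν : Measure α) {u : α → ℝ≥0∞}
    (hu : AEMeasurable u ν) : (∫⁻ x, u x ∂ν) ^ 2 ≤ ν univ * ∫⁻ x, u x ^ 2 ∂ν := by
  have h := ENNReal.lintegral_mul_le_Lp_mul_Lq ν Real.HolderConjugate.two_two
    (aemeasurable_const (b := (1 : ℝ≥0∞))) hu
  have hsq (x : ℝ≥0∞) : (x ^ (1 / 2 : ℝ)) ^ 2 = x := by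
    rw [← ENNReal.rpow_two, ← ENNReal.rpow_mul]
    norm_num
  have h2 := pow_le_pow_left' h 2
  rw [mul_pow, hsq, hsq] at h2
  simpa using h2

lemma enorm_sub_dilate_sq_le {g : ℂ → ℂ} (hg : DifferentiableOn ℂ g disc) {r : ℝ} (hr0 : 0 ≤ r)
    (hr : r < 1) {z : ℂ} (hz : z ∈ disc) :
    ‖g z - g (r * z)‖ₑ ^ 2 ≤
      ENNReal.ofReal (1 - r) * ∫⁻ s in Ioc r 1, ‖deriv g (s * z)‖ₑ ^ 2 := by
  have hmem : ∀ s ∈ uIcc r 1, (s : ℂ) * z ∈ disc := fun s hs => by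
    rw [uIcc_of_le hr.le] at hs
    exact ofReal_mul_mem_disc (hr0.trans hs.1) hs.2 hz
  have hcont : ContinuousOn (fun s : ℝ => z * deriv g (s * z)) (uIcc r 1) :=
    continuousOn_const.mul ((hg.deriv isOpen_disc).continuousOn.comp (by fun_prop) hmem)
  have hderiv : ∀ s ∈ uIcc r 1,
      HasDerivAt (fun s : ℝ => g (s * z)) (z * deriv g (s * z)) s := by
    intro s hs
    have h1 := (hg.differentiableAt (isOpen_disc.mem_nhds (hmem s hs))).hasDerivAt
    have h2 : HasDerivAt (fun s : ℝ => (s : ℂ) * z) z s := by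
      simpa using (hasDerivAt_id (s : ℂ)).comp_ofReal.mul_const z
    rw [mul_comm]
    exact h1.comp s h2
  have h := intervalIntegral.integral_eq_sub_of_hasDerivAt hderiv hcont.intervalIntegrable
  rw [ofReal_one, one_mul] at h
  have hm := measurable_deriv g
  have h3 : ‖g z - g (r * z)‖ₑ ≤ ∫⁻ s in Ioc r 1, ‖deriv g (s * z)‖ₑ := by
    rw [← h, intervalIntegral.integral_of_le hr.le]
    refine (enorm_integral_le_lintegral_enorm _).trans (lintegral_mono fun s => ?_)
    rw [enorm_mul]
    refine mul_le_of_le_one_left' ?_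
    rw [← ofReal_norm, ENNReal.ofReal_le_one]
    exact (mem_ball_zero_iff.1 hz).le
  refine (pow_le_pow_left' h3 2).trans ((sq_lintegral_le _ (by fun_prop)).trans_eq ?_)
  simp

lemma lintegral_deriv_dilate_le {μ : Measure ℂ} [SFinite μ] (hμ : OnCircle μ) {g : ℂ → ℂ}
    (hg : DifferentiableOn ℂ g disc) {s : ℝ} (hs0 : 1 / 2 ≤ s) (hs : s ≤ 1) :
    ∫⁻ z in disc, ‖deriv g (s * z)‖ₑ ^ 2 * weight μ z ≤ 2 * dirichletEnergy μ g := by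
  rcases hs.eq_or_lt with rfl | hs
  · simpa [dirichletEnergy] using le_mul_of_one_le_left' (by norm_num)
  · refine (lintegral_weight_dilate hμ (measurable_deriv g) (hg.deriv isOpen_disc)
      (by linarith) hs).trans ?_
    rw [dirichletEnergy, ← ENNReal.ofReal_ofNat 2]
    gcongr
    rw [inv_le_comm₀ (by linarith) (by norm_num)]
    linarith

lemma lintegral_sub_dilate_le {μ : Measure ℂ} [SFinite μ] (hμ : OnCircle μ) {g : ℂ → ℂ}
    (hg : DifferentiableOn ℂ g disc) {r : ℝ} (hr0 : 1 / 2 ≤ r) (hr : r < 1) :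
    ∫⁻ z in disc, ‖g z - g (r * z)‖ₑ ^ 2 * weight μ z ≤
      ENNReal.ofReal (1 - r) ^ 2 * (2 * dirichletEnergy μ g) := by
  have hW := measurable_weight μ
  have hm := measurable_deriv g
  calc ∫⁻ z in disc, ‖g z - g (r * z)‖ₑ ^ 2 * weight μ z
      ≤ ∫⁻ z in disc, ENNReal.ofReal (1 - r) *
          ∫⁻ s in Ioc r 1, ‖deriv g (s * z)‖ₑ ^ 2 * weight μ z := by
        refine setLIntegral_mono' measurableSet_disc fun z hz => ?_
        rw [lintegral_mul_const _ (by fun_prop), ← mul_assoc]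
        gcongr
        exact enorm_sub_dilate_sq_le hg (by linarith) hr hz
    _ = ENNReal.ofReal (1 - r) *
          ∫⁻ s in Ioc r 1, ∫⁻ z in disc, ‖deriv g (s * z)‖ₑ ^ 2 * weight μ z := by
        rw [lintegral_const_mul' _ _ ENNReal.ofReal_ne_top, lintegral_lintegral_swap]
        exact Measurable.aemeasurable (by fun_prop)
    _ ≤ ENNReal.ofReal (1 - r) * ∫⁻ s in Ioc r 1, 2 * dirichletEnergy μ g := by
        refine mul_le_mul' le_rfl ?_
        refine setLIntegral_mono' (measurableSet_Ioc (a := r) (b := 1)) fun s hs => ?_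
        exact lintegral_deriv_dilate_le hμ hg (hr0.trans hs.1.le) hs.2
    _ = ENNReal.ofReal (1 - r) ^ 2 * (2 * dirichletEnergy μ g) := by
        simp; ring

lemma lintegral_sq_weight_ne_top {μ : Measure ℂ} [IsFiniteMeasure μ] (hμ : OnCircle μ) {g : ℂ → ℂ}
    (hg : DifferentiableOn ℂ g disc) (he : dirichletEnergy μ g ≠ ∞) :
    ∫⁻ z in disc, ‖g z‖ₑ ^ 2 * weight μ z ≠ ∞ := by
  have hW := measurable_weight μ
  have hsub : closedBall (0 : ℂ) (1 / 2) ⊆ disc := closedBall_subset_ball (by norm_num)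
  obtain ⟨M, hM⟩ := (isCompact_closedBall (0 : ℂ) (1 / 2)).exists_bound_of_continuousOn
    (hg.continuousOn.mono hsub)
  have key : ∫⁻ z in disc, ‖g z‖ₑ ^ 2 * weight μ z ≤
      2 * ENNReal.ofReal M ^ 2 * (∫⁻ z in disc, weight μ z) +
        2 * (ENNReal.ofReal (1 - 1 / 2) ^ 2 * (2 * dirichletEnergy μ g)) := by
    calc ∫⁻ z in disc, ‖g z‖ₑ ^ 2 * weight μ z
        ≤ ∫⁻ z in disc, (2 * ENNReal.ofReal M ^ 2 * weight μ z +
            2 * (‖g z - g ((1 / 2 : ℝ) * z)‖ₑ ^ 2 * weight μ z)) := by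
          refine setLIntegral_mono' measurableSet_disc fun z hz => ?_
          rw [← mul_assoc, ← add_mul]
          gcongr
          have h := enorm_add_sq_le (g ((1 / 2 : ℝ) * z)) (g z - g ((1 / 2 : ℝ) * z))
          rw [add_sub_cancel] at h
          refine h.trans ?_
          gcongr
          rw [← ofReal_norm]
          refine ENNReal.ofReal_le_ofReal (hM _ ?_)
          have := mem_ball_zero_iff.1 hz
          rw [mem_closedBall_zero_iff, norm_mul, norm_real, Real.norm_of_nonneg (by norm_num)]
          linarith
      _ = 2 * ENNReal.ofReal M ^ 2 * (∫⁻ z in disc, weight μ z) +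
            2 * ∫⁻ z in disc, ‖g z - g ((1 / 2 : ℝ) * z)‖ₑ ^ 2 * weight μ z := by
          rw [lintegral_add_left (by fun_prop), lintegral_const_mul _ hW,
            lintegral_const_mul' _ _ (by simp)]
      _ ≤ _ := by
          gcongr
          exact lintegral_sub_dilate_le hμ hg le_rfl (by norm_num)
  have h1 := (lintegral_weight_lt_top hμ).ne
  exact ne_top_of_le_ne_top (by finiteness) key


/-! ### Bounded quotients -/

lemma exists_bounded_quotient {F g : ℂ → ℂ} (hF : DifferentiableOn ℂ F disc)
    (hg : DifferentiableOn ℂ g disc) {C : ℝ} (hC : 0 ≤ C) (h : ∀ z ∈ disc, ‖F z‖ ≤ C * ‖g z‖) :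
    ∃ φ : ℂ → ℂ, DifferentiableOn ℂ φ disc ∧ (∀ z ∈ disc, ‖φ z‖ ≤ C) ∧
      ∀ z ∈ disc, F z = φ z * g z := by
  classical
  by_cases hg0 : EqOn g 0 disc
  · refine ⟨0, differentiableOn_const _, by simpa using fun _ _ => hC, fun z hz => ?_⟩
    have := h z hz
    rw [hg0 hz] at this ⊢
    simpa using this
  have hne : ∀ z ∈ disc, ∀ᶠ w in 𝓝[≠] z, g w ≠ 0 := fun z hz => by
    by_contra hcon
    exact hg0 ((hg.analyticOnNhd isOpen_disc).eqOn_zero_of_preconnected_of_frequently_eq_zero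
      (convex_ball 0 1).isPreconnected hz hcon)
  have hq : ∀ z ∈ disc, ‖F z / g z‖ ≤ C := fun z hz => by
    rw [norm_div]
    exact div_le_of_le_mul₀ (norm_nonneg _) hC (h z hz)
  let φ : ℂ → ℂ := fun z => if g z = 0 then limUnder (𝓝[≠] z) (fun w => F w / g w) else F z / g z
  have hφ : ∀ z, g z ≠ 0 → φ z = F z / g z := fun z hz => if_neg hz
  have hφd : ∀ z ∈ disc, DifferentiableAt ℂ φ z := by
    intro z hz
    by_cases hgz : g z = 0
    · obtain ⟨s, hs, hso, hzs⟩ := _root_.mem_nhds_iff.1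
        (inter_mem (isOpen_disc.mem_nhds hz) (eventually_nhdsWithin_iff.1 (hne z hz)))
      have hnz : ∀ w ∈ s \ {z}, g w ≠ 0 := fun w hw => (hs hw.1).2 hw.2
      have hd : DifferentiableOn ℂ (fun w => F w / g w) (s \ {z}) :=
        (hF.mono fun w hw => (hs hw.1).1).div (hg.mono fun w hw => (hs hw.1).1) hnz
      have hb : BddAbove (norm ∘ (fun w => F w / g w) '' (s \ {z})) :=
        ⟨C, by rintro _ ⟨w, hw, rfl⟩; exact hq w (hs hw.1).1⟩
      refine ((differentiableOn_update_limUnder_of_bddAbove (hso.mem_nhds hzs) hd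
        hb).differentiableAt (hso.mem_nhds hzs)).congr_of_eventuallyEq ?_
      filter_upwards [hso.mem_nhds hzs] with w hw
      rcases eq_or_ne w z with rfl | hwz
      · simp [φ, hgz]
      · rw [Function.update_of_ne hwz, hφ w (hnz w ⟨hw, hwz⟩)]
    · have h1 := hg.differentiableAt (isOpen_disc.mem_nhds hz)
      refine ((hF.differentiableAt (isOpen_disc.mem_nhds hz)).div h1 hgz).congr_of_eventuallyEq ?_
      filter_upwards [h1.continuousAt.eventually_ne hgz] with w hw
      exact hφ w hw
  refine ⟨φ, fun z hz => (hφd z hz).differentiableWithinAt, fun z hz => ?_, fun z hz => ?_⟩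
  · refine le_of_tendsto ((hφd z hz).continuousAt.tendsto.mono_left
      (nhdsWithin_le_nhds (s := {z}ᶜ))).norm ?_
    filter_upwards [hne z hz, nhdsWithin_le_nhds (isOpen_disc.mem_nhds hz)] with w hw hwd
    rw [hφ w hw]
    exact hq w hwd
  · by_cases hgz : g z = 0
    · have := h z hz
      rw [hgz] at this ⊢
      simpa using this
    · rw [hφ z hgz, div_mul_cancel₀ _ hgz]

/-! ### Multiplying by dilations of a bounded multiplier -/

lemma norm_deriv_le_of_bounded {φ : ℂ → ℂ} (hφ : DifferentiableOn ℂ φ disc) {C : ℝ}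
    (hC : ∀ z ∈ disc, ‖φ z‖ ≤ C) {r : ℝ} (hr : r < 1) {w : ℂ} (hw : ‖w‖ < r) :
    ‖deriv φ w‖ ≤ C / (1 - r) := by
  have hsub : closedBall w (1 - r) ⊆ disc := fun x hx => mem_ball_zero_iff.2 <| by
    have h1 := mem_closedBall_iff_norm.1 hx
    have h2 := norm_le_norm_add_norm_sub' x w
    linarith
  have hd : DiffContOnCl ℂ φ (ball w (1 - r)) :=
    DifferentiableOn.diffContOnCl (hφ.mono (closure_ball_subset_closedBall.trans hsub))
  exact norm_deriv_le_of_forall_mem_sphere_norm_le (by linarith) hd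
    fun z hz => hC z (hsub (sphere_subset_closedBall hz))

lemma deriv_dilate_mul {φ g F : ℂ → ℂ} (hφ : DifferentiableOn ℂ φ disc)
    (hg : DifferentiableOn ℂ g disc) (hF : ∀ z ∈ disc, F z = φ z * g z) {r : ℝ} (hr0 : 0 ≤ r)
    (hr : r < 1) {z : ℂ} (hz : z ∈ disc) :
    deriv (fun z => φ (r * z) * g z) z = (r * deriv φ (r * z) * (g z - g (r * z)) +
      r * deriv F (r * z)) + (-(r * φ (r * z) * deriv g (r * z)) + φ (r * z) * deriv g z) := by
  have hrz := ofReal_mul_mem_disc hr0 hr.le hz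
  have h1 := hφ.differentiableAt (isOpen_disc.mem_nhds hrz)
  have h2 := hg.differentiableAt (isOpen_disc.mem_nhds hrz)
  have h3 := hg.differentiableAt (isOpen_disc.mem_nhds hz)
  have h4 : HasDerivAt (fun z => φ (r * z)) (deriv φ (r * z) * r) z := by
    have := (hasDerivAt_id z).const_mul (r : ℂ)
    rw [mul_one] at this
    exact h1.hasDerivAt.comp z this
  have h5 : deriv F (r * z) = deriv φ (r * z) * g (r * z) + φ (r * z) * deriv g (r * z) := by
    rw [← deriv_fun_mul h1 h2]
    exact Filter.EventuallyEq.deriv_eq (eventually_of_mem (isOpen_disc.mem_nhds hrz) hF)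
  rw [(h4.fun_mul h3.hasDerivAt).deriv, h5]
  ring

lemma energy_dilate_mul_le {μ : Measure ℂ} [SFinite μ] (hμ : OnCircle μ) {φ g F : ℂ → ℂ}
    (hφ : DifferentiableOn ℂ φ disc) (hg : DifferentiableOn ℂ g disc)
    (hF : ∀ z ∈ disc, F z = φ z * g z) {C : ℝ} (hC : ∀ z ∈ disc, ‖φ z‖ ≤ C)
    {r : ℝ} (hr0 : 1 / 2 ≤ r) (hr : r < 1) :
    energy μ (fun z => φ (r * z) * g z) ≤ ENNReal.ofReal C ^ 2 * hardyEnergy g +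
      (20 * ENNReal.ofReal C ^ 2 * dirichletEnergy μ g + 8 * dirichletEnergy μ F) := by
  have hFd : DifferentiableOn ℂ F disc := (hφ.mul hg).congr hF
  have hr0' : 0 ≤ r := by linarith
  have hφe : ∀ z ∈ disc, ‖φ (r * z)‖ₑ ≤ ENNReal.ofReal C := fun z hz => by
    rw [← ofReal_norm]
    exact ENNReal.ofReal_le_ofReal (hC _ (ofReal_mul_mem_disc hr0' hr.le hz))
  refine add_le_add (hardyEnergy_mul_le hφe ENNReal.ofReal_ne_top) ?_
  have hC0 : 0 ≤ C := (norm_nonneg _).trans (hC 0 (mem_ball_self one_pos))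
  have hre : ‖(r : ℂ)‖ₑ ≤ 1 := by
    rw [← ofReal_norm, norm_real, Real.norm_of_nonneg hr0', ENNReal.ofReal_le_one]
    exact hr.le
  have hφ' : ∀ z ∈ disc, ‖deriv φ (r * z)‖ₑ ≤ ENNReal.ofReal (C / (1 - r)) := fun z hz => by
    rw [← ofReal_norm]
    refine ENNReal.ofReal_le_ofReal (norm_deriv_le_of_bounded hφ hC hr ?_)
    rw [norm_mul, norm_real, Real.norm_of_nonneg hr0']
    exact mul_lt_of_lt_one_right (by linarith) (mem_ball_zero_iff.1 hz)
  have hW := measurable_weight μ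
  have hm := measurable_deriv g
  have hm' := measurable_deriv F
  set c := ENNReal.ofReal C with hc
  set d := ENNReal.ofReal (C / (1 - r)) with hd
  have hcd : d * ENNReal.ofReal (1 - r) = c := by
    rw [hc, hd, ← ENNReal.ofReal_mul (by have := sub_pos.2 hr; positivity),
      div_mul_cancel₀ _ (sub_pos.2 hr).ne']
  calc dirichletEnergy μ (fun z => φ (r * z) * g z)
      ≤ ∫⁻ z in disc, (4 * d ^ 2 * (‖g z - g (r * z)‖ₑ ^ 2 * weight μ z) +
          (4 * (‖deriv F (r * z)‖ₑ ^ 2 * weight μ z) +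
          (4 * c ^ 2 * (‖deriv g (r * z)‖ₑ ^ 2 * weight μ z) +
            4 * c ^ 2 * (‖deriv g z‖ₑ ^ 2 * weight μ z)))) := by
        refine setLIntegral_mono' measurableSet_disc fun z hz => ?_
        rw [deriv_dilate_mul hφ hg hF hr0' hr hz]
        calc _ ≤ (2 * (2 * ‖r * deriv φ (r * z) * (g z - g (r * z))‖ₑ ^ 2 +
              2 * ‖r * deriv F (r * z)‖ₑ ^ 2) + 2 * (2 * ‖-(r * φ (r * z) * deriv g (r * z))‖ₑ ^ 2 +
              2 * ‖φ (r * z) * deriv g z‖ₑ ^ 2)) * weight μ z := by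
              gcongr
              refine (enorm_add_sq_le _ _).trans ?_
              gcongr
              · exact enorm_add_sq_le _ _
              · exact enorm_add_sq_le _ _
          _ ≤ (2 * (2 * (1 * d * ‖g z - g (r * z)‖ₑ) ^ 2 +
              2 * (1 * ‖deriv F (r * z)‖ₑ) ^ 2) + 2 * (2 * (1 * c * ‖deriv g (r * z)‖ₑ) ^ 2 +
              2 * (c * ‖deriv g z‖ₑ) ^ 2)) * weight μ z := by
              simp only [enorm_neg, enorm_mul]
              gcongr
              · exact hφ' z hz
              · exact hφe z hz
              · exact hφe z hz
          _ = _ := by ring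
    _ = 4 * d ^ 2 * (∫⁻ z in disc, ‖g z - g (r * z)‖ₑ ^ 2 * weight μ z) +
          (4 * (∫⁻ z in disc, ‖deriv F (r * z)‖ₑ ^ 2 * weight μ z) +
          (4 * c ^ 2 * (∫⁻ z in disc, ‖deriv g (r * z)‖ₑ ^ 2 * weight μ z) +
            4 * c ^ 2 * dirichletEnergy μ g)) := by
        rw [lintegral_add_right _ (by fun_prop), lintegral_add_left (by fun_prop),
          lintegral_add_left (by fun_prop), lintegral_const_mul' _ _ (by finiteness),
          lintegral_const_mul' _ _ (by finiteness), lintegral_const_mul' _ _ (by finiteness),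
          lintegral_const_mul' _ _ (by finiteness), dirichletEnergy]
    _ ≤ 4 * d ^ 2 * (ENNReal.ofReal (1 - r) ^ 2 * (2 * dirichletEnergy μ g)) +
          (4 * (2 * dirichletEnergy μ F) +
          (4 * c ^ 2 * (2 * dirichletEnergy μ g) + 4 * c ^ 2 * dirichletEnergy μ g)) := by
        gcongr
        · exact lintegral_sub_dilate_le hμ hg hr0 hr
        · exact lintegral_deriv_dilate_le hμ hFd hr0 hr.le
        · exact lintegral_deriv_dilate_le hμ hg hr0 hr.le
    _ = 20 * c ^ 2 * dirichletEnergy μ g + 8 * dirichletEnergy μ F := by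
        rw [← hcd]
        ring

/-! ### Polynomial approximation of dilations -/

lemma exists_polynomial_near_dilate {φ : ℂ → ℂ} (hφ : DifferentiableOn ℂ φ disc) {r : ℝ}
    (hr0 : 0 ≤ r) (hr : r < 1) {ε : ℝ} (hε : 0 < ε) :
    ∃ p : Polynomial ℂ, ∀ z ∈ disc, ‖φ (r * z) - p.eval z‖ ≤ ε ∧
      ‖deriv (fun z => φ (r * z) - p.eval z) z‖ ≤ ε := by
  obtain ⟨ρ, hrρ, hρ⟩ := exists_between hr
  lift ρ to NNReal using hr0.trans hrρ.le
  have hρ0 : 0 < ρ := by exact_mod_cast hr0.trans_lt hrρ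
  have hser := (hφ.mono (closedBall_subset_ball hρ)).hasFPowerSeriesOnBall hρ0
  set P := cauchyPowerSeries φ 0 ρ
  let Q : ℕ → Polynomial ℂ := fun n =>
    ∑ k ∈ Finset.range n, Polynomial.C (P.coeff k) * Polynomial.X ^ k
  have hQ : ∀ n z, P.partialSum n z = (Q n).eval z := fun n z => by
    simp only [FormalMultilinearSeries.partialSum, Q, Polynomial.eval_finsetSum,
      Polynomial.eval_mul, Polynomial.eval_C, Polynomial.eval_pow, Polynomial.eval_X,
      FormalMultilinearSeries.apply_eq_pow_smul_coeff, smul_eq_mul, mul_comm]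
  have hlim : TendstoLocallyUniformlyOn (fun n z => (Q n).eval z) φ atTop (ball 0 ρ) := by
    have := hser.tendstoLocallyUniformlyOn'
    simpa only [hQ, sub_zero, Metric.eball_coe] using this
  have hlim' := hlim.deriv (.of_forall fun n => (Q n).differentiable.differentiableOn) isOpen_ball
  have hsub : closedBall (0 : ℂ) r ⊆ ball 0 ρ := closedBall_subset_ball hrρ
  rw [tendstoLocallyUniformlyOn_iff_forall_isCompact isOpen_ball] at hlim hlim'
  have h1 := Metric.tendstoUniformlyOn_iff.1 (hlim _ hsub (isCompact_closedBall 0 r)) ε hε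
  have h2 := Metric.tendstoUniformlyOn_iff.1 (hlim' _ hsub (isCompact_closedBall 0 r)) ε hε
  obtain ⟨n, hn1, hn2⟩ := (h1.and h2).exists
  refine ⟨(Q n).comp (Polynomial.C (r : ℂ) * Polynomial.X), fun z hz => ?_⟩
  have hz1 := mem_ball_zero_iff.1 hz
  have hrz : (r : ℂ) * z ∈ closedBall (0 : ℂ) r := by
    rw [mem_closedBall_zero_iff, norm_mul, norm_real, Real.norm_of_nonneg hr0]
    exact mul_le_of_le_one_right hr0 hz1.le
  simp only [Polynomial.eval_comp, Polynomial.eval_mul, Polynomial.eval_C, Polynomial.eval_X]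
  refine ⟨by simpa [dist_eq_norm] using (hn1 _ hrz).le, ?_⟩
  have hd : HasDerivAt (fun z : ℂ => (r : ℂ) * z) r z := by
    simpa using (hasDerivAt_id z).const_mul (r : ℂ)
  have h3 := (hφ.differentiableAt (isOpen_disc.mem_nhds
    (ofReal_mul_mem_disc hr0 hr.le hz))).hasDerivAt.comp z hd
  have h4 := ((Q n).differentiable.differentiableAt (x := (r : ℂ) * z)).hasDerivAt.comp z hd
  have h5 : HasDerivAt (fun z => φ (r * z) - (Q n).eval (r * z))
    (deriv φ (r * z) * r - deriv (fun z => (Q n).eval z) (r * z) * r) z := h3.fun_sub h4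
  rw [h5.deriv, ← sub_mul, norm_mul, norm_real, Real.norm_of_nonneg hr0]
  have h6 := hn2 _ hrz
  rw [dist_eq_norm] at h6
  exact (mul_le_of_le_one_right (norm_nonneg _) hr.le).trans h6.le

/-- `u` lies in the closure, with respect to `energy μ`, of the polynomial multiples of `g`. -/
def MemSpanClosure (μ : Measure ℂ) (g u : ℂ → ℂ) : Prop :=
  ∀ ε : ℝ≥0∞, 0 < ε → ∃ p : Polynomial ℂ, energy μ (fun z => u z - p.eval z * g z) < ε

lemma memSpanClosure_dilate_mul {μ : Measure ℂ} [IsFiniteMeasure μ] (hμ : OnCircle μ)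
    {φ g : ℂ → ℂ} (hφ : DifferentiableOn ℂ φ disc) (hg : DifferentiableOn ℂ g disc)
    (he : energy μ g ≠ ∞) {r : ℝ} (hr0 : 0 ≤ r) (hr : r < 1) :
    MemSpanClosure μ g (fun z => φ (r * z) * g z) := by
  intro ε hε
  have hK := lintegral_sq_weight_ne_top hμ hg (ENNReal.add_ne_top.1 he).2
  set K := 2 * energy μ g + 2 * ∫⁻ z in disc, ‖g z‖ₑ ^ 2 * weight μ z
  have hKt : K ≠ ∞ := by finiteness
  have hlim : Tendsto (fun δ : ℝ => ENNReal.ofReal δ ^ 2 * K) (𝓝[>] 0) (𝓝 0) := by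
    have h1 : Tendsto (fun δ : ℝ => ENNReal.ofReal δ) (𝓝[>] 0) (𝓝 0) := by
      simpa using (ENNReal.continuous_ofReal.tendsto 0).mono_left nhdsWithin_le_nhds
    have h2 := ENNReal.Tendsto.mul_const (b := K) (ENNReal.Tendsto.pow (n := 2) h1) (Or.inr hKt)
    simpa using h2
  obtain ⟨δ, hδ, hδ0⟩ := ((hlim.eventually_lt_const hε).and self_mem_nhdsWithin).exists
  obtain ⟨p, hp⟩ := exists_polynomial_near_dilate hφ hr0 hr hδ0
  refine ⟨p, lt_of_le_of_lt ?_ hδ⟩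
  simp only [← sub_mul]
  refine energy_mul_le (φ := fun z => φ (r * z) - p.eval z) ?_ hg ?_ ?_ ENNReal.ofReal_ne_top
  · exact (hφ.comp (by fun_prop) fun z hz => ofReal_mul_mem_disc hr0 hr.le hz).sub
      p.differentiable.differentiableOn
  · intro z hz
    rw [← ofReal_norm]
    exact ENNReal.ofReal_le_ofReal (hp z hz).1
  · intro z hz
    rw [← ofReal_norm]
    exact ENNReal.ofReal_le_ofReal (hp z hz).2

lemma convex_setOf_memSpanClosure {μ : Measure ℂ} [SFinite μ] {g : ℂ → ℂ}
    (hg : DifferentiableOn ℂ g disc) :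
    Convex ℝ {u | DifferentiableOn ℂ u disc ∧ MemSpanClosure μ g u} := by
  rintro u ⟨hu, hu'⟩ v ⟨hv, hv'⟩ a b ha hb hab
  refine ⟨(hu.const_smul a).add (hv.const_smul b), fun ε hε => ?_⟩
  have hε4 : 0 < ε / 4 := ENNReal.div_pos hε.ne' (by simp)
  obtain ⟨p, hp⟩ := hu' (ε / 4) hε4
  obtain ⟨q, hq⟩ := hv' (ε / 4) hε4
  refine ⟨Polynomial.C (a : ℂ) * p + Polynomial.C (b : ℂ) * q, ?_⟩
  have hU : DifferentiableOn ℂ (fun z => u z - p.eval z * g z) disc :=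
    hu.sub (p.differentiable.differentiableOn.mul hg)
  have hV : DifferentiableOn ℂ (fun z => v z - q.eval z * g z) disc :=
    hv.sub (q.differentiable.differentiableOn.mul hg)
  have hsplit : (fun z => (a • u + b • v) z -
      (Polynomial.C (a : ℂ) * p + Polynomial.C (b : ℂ) * q).eval z * g z) =
      (fun z => (a : ℂ) * (u z - p.eval z * g z)) + fun z => (b : ℂ) * (v z - q.eval z * g z) := by
    ext z
    simp only [Pi.add_apply, Pi.smul_apply, real_smul, Polynomial.eval_add, Polynomial.eval_mul,
      Polynomial.eval_C]
    ring
  have hle {c : ℝ} (hc : 0 ≤ c) (hc1 : c ≤ 1) : ‖(c : ℂ)‖ₑ ^ 2 ≤ 1 := by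
    refine pow_le_one' ?_ 2
    rw [← ofReal_norm, norm_real, Real.norm_of_nonneg hc, ENNReal.ofReal_le_one]
    exact hc1
  rw [hsplit]
  calc _ ≤ 2 * (‖(a : ℂ)‖ₑ ^ 2 * energy μ _) + 2 * (‖(b : ℂ)‖ₑ ^ 2 * energy μ _) := by
        rw [← energy_const_mul, ← energy_const_mul]
        exact energy_add_le μ (hU.const_mul _) (hV.const_mul _)
    _ ≤ 2 * (1 * energy μ (fun z => u z - p.eval z * g z)) +
          2 * (1 * energy μ (fun z => v z - q.eval z * g z)) := by
        gcongr
        · exact hle ha (by linarith)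
        · exact hle hb (by linarith)
    _ < 2 * (ε / 4) + 2 * (ε / 4) := by
        rw [one_mul, one_mul]
        gcongr <;> simp
    _ = ε := by
        rw [← add_mul, mul_comm, show (2 + 2 : ℝ≥0∞) = 4 by norm_num,
          ENNReal.div_mul_cancel] <;> norm_num

/-! ### Weak limits -/

lemma exists_cauchy_convexHull {V : Type*} [AddCommGroup V] [Module ℝ V] {N : V → ℝ}
    (hN : ∀ v, 0 ≤ N v) (hpar : ∀ u v, N (u + v) + N (u - v) = 2 * N u + 2 * N v)
    (hhalf : ∀ v, N ((1 / 2 : ℝ) • v) = N v / 4) {x : ℕ → V} {K : ℝ} (hK : ∀ n, N (x n) ≤ K) :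
    ∃ y : ℕ → V, (∀ n, y n ∈ convexHull ℝ (x '' Ici n)) ∧
      ∀ ε > 0, ∃ M, ∀ n ≥ M, ∀ m ≥ n, N (y m - y n) < ε := by
  let H : ℕ → Set V := fun n => convexHull ℝ (x '' Ici n)
  have hxH (n) : x n ∈ H n := subset_convexHull ℝ _ (mem_image_of_mem x self_mem_Ici)
  have hanti {n m : ℕ} (h : n ≤ m) : H m ⊆ H n :=
    convexHull_mono (image_mono (Ici_subset_Ici.2 h))
  have hbdd (n) : BddBelow (N '' H n) := ⟨0, by rintro _ ⟨v, -, rfl⟩; exact hN v⟩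
  have hne (n) : (N '' H n).Nonempty := ⟨_, x n, hxH n, rfl⟩
  let I : ℕ → ℝ := fun n => sInf (N '' H n)
  have hI {n : ℕ} {v : V} (hv : v ∈ H n) : I n ≤ N v := csInf_le (hbdd n) ⟨v, hv, rfl⟩
  have hmono : Monotone I := fun n m h => csInf_le_csInf (hbdd n) (hne m) (image_mono (hanti h))
  have hbI : BddAbove (range I) := ⟨K, by rintro _ ⟨n, rfl⟩; exact (hI (hxH n)).trans (hK n)⟩
  have hy (n : ℕ) : ∃ v ∈ H n, N v < I n + 1 / (n + 1) := by
    obtain ⟨_, ⟨v, hv, rfl⟩, h⟩ := exists_lt_of_csInf_lt (hne n)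
      (lt_add_of_pos_right (I n) (Nat.one_div_pos_of_nat (α := ℝ) (n := n)))
    exact ⟨v, hv, h⟩
  choose y hyH hyN using hy
  refine ⟨y, hyH, fun ε hε => ?_⟩
  have h1 : ∀ᶠ n in atTop, (⨆ n, I n) - ε / 4 < I n :=
    (tendsto_atTop_ciSup hmono hbI).eventually_const_lt (by linarith)
  have h2 : ∀ᶠ n : ℕ in atTop, 1 / ((n : ℝ) + 1) < ε / 8 :=
    tendsto_one_div_add_atTop_nhds_zero_nat.eventually_lt_const (by linarith)
  obtain ⟨M, hM⟩ := eventually_atTop.1 (h1.and h2)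
  refine ⟨M, fun n hn m hm => ?_⟩
  have hmid : (1 / 2 : ℝ) • (y m + y n) ∈ H n := by
    rw [smul_add]
    exact convex_convexHull ℝ _ (hanti hm (hyH m)) (hyH n) (by norm_num) (by norm_num)
      (by norm_num)
  have h3 := hI hmid
  rw [hhalf] at h3
  have h4 := hpar (y m) (y n)
  have h5 := le_ciSup hbI m
  have h6 := hyN m
  have h7 := hyN n
  have h8 := (hM n hn).1
  have h9 := (hM n hn).2
  have h10 := (hM m (hn.trans hm)).2
  linarith

lemma tendsto_of_mem_convexHull {V E : Type*} [AddCommGroup V] [Module ℝ V]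
    [SeminormedAddCommGroup E] [NormedSpace ℝ E] (L : V →ₗ[ℝ] E) {x y : ℕ → V}
    (hy : ∀ n, y n ∈ convexHull ℝ (x '' Ici n)) {l : E}
    (hx : Tendsto (fun n => L (x n)) atTop (𝓝 l)) : Tendsto (fun n => L (y n)) atTop (𝓝 l) := by
  rw [Metric.tendsto_atTop] at hx ⊢
  intro ε hε
  obtain ⟨M, hM⟩ := hx ε hε
  refine ⟨M, fun n hn => ?_⟩
  refine convexHull_min (t := L ⁻¹' ball l ε) ?_ ((convex_ball l ε).linear_preimage L) (hy n)
  rintro _ ⟨k, hk, rfl⟩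
  exact hM k (hn.trans hk)

lemma energy_le_of_tendsto {μ : Measure ℂ} [IsFiniteMeasure μ] (hμ : OnCircle μ)
    {u : ℕ → ℂ → ℂ} {v : ℂ → ℂ} (hu : ∀ n, DifferentiableOn ℂ (u n) disc)
    (h : ∀ z ∈ disc, Tendsto (fun n => u n z) atTop (𝓝 (v z)))
    (h' : ∀ z ∈ disc, Tendsto (fun n => deriv (u n) z) atTop (𝓝 (deriv v z)))
    {K : ℝ≥0∞} (hK : ∀ᶠ n in atTop, energy μ (u n) ≤ K) : energy μ v ≤ 2 * K := by
  have hW := measurable_weight μ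
  rw [energy, two_mul]
  refine add_le_add (iSup_le fun r => ?_) ?_
  · have hc (n) := continuous_comp_circle (hu n) r.2.1.le r.2.2
    calc meanSq v r = ∫⁻ t, liminf (fun n => ‖u n (r * bpt t)‖ₑ ^ 2) atTop ∂θm := by
          refine lintegral_congr fun t => (Tendsto.liminf_eq ?_).symm
          exact ENNReal.Tendsto.pow (h _ (mul_bpt_mem_disc r.2.1.le r.2.2 t)).enorm
      _ ≤ liminf (fun n => meanSq (u n) r) atTop := lintegral_liminf_le fun n => by
          exact (hc n).measurable.enorm.pow_const 2
      _ ≤ K := by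
          refine liminf_le_of_frequently_le' (hK.frequently.mono fun n hn => ?_)
          exact (le_iSup (fun r : Ioo (0 : ℝ) 1 => meanSq (u n) r) r).trans
            (le_self_add.trans hn)
  · calc dirichletEnergy μ v =
          ∫⁻ z in disc, liminf (fun n => ‖deriv (u n) z‖ₑ ^ 2 * weight μ z) atTop := by
          refine setLIntegral_congr_fun measurableSet_disc fun z hz => (Tendsto.liminf_eq ?_).symm
          rw [weight_eq hμ hz]
          exact ENNReal.Tendsto.mul_const (ENNReal.Tendsto.pow (h' z hz).enorm)
            (Or.inr ENNReal.ofReal_ne_top)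
      _ ≤ liminf (fun n => dirichletEnergy μ (u n)) atTop := lintegral_liminf_le fun n => by
          have := measurable_deriv (u n)
          fun_prop
      _ ≤ K := by
          refine liminf_le_of_frequently_le' (hK.frequently.mono fun n hn => ?_)
          exact le_add_self.trans hn

/-- The holomorphic functions on the disc of finite energy. -/
def finiteEnergy (μ : Measure ℂ) [SFinite μ] : Submodule ℝ (ℂ → ℂ) where
  carrier := {u | DifferentiableOn ℂ u disc ∧ energy μ u ≠ ∞}
  add_mem' {u v} hu hv := by
    refine ⟨hu.1.add hv.1, ne_top_of_le_ne_top ?_ (energy_add_le μ hu.1 hv.1)⟩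
    have h1 := hu.2
    have h2 := hv.2
    finiteness
  zero_mem' := by
    refine ⟨differentiableOn_const 0, ?_⟩
    have h := energy_const_mul μ 0 0
    simp only [zero_mul, enorm_zero, ne_eq, OfNat.ofNat_ne_zero, not_false_eq_true, zero_pow] at h
    exact ne_of_eq_of_ne h ENNReal.zero_ne_top
  smul_mem' c u hu := by
    refine ⟨hu.1.const_smul c, ?_⟩
    have h1 := hu.2
    have : c • u = fun z => (c : ℂ) * u z := by ext z; simp
    rw [this, energy_const_mul]
    finiteness

/-- Evaluation at `z`, as a functional on `finiteEnergy μ`. -/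
def evalFunctional (μ : Measure ℂ) [SFinite μ] (z : ℂ) : finiteEnergy μ →ₗ[ℝ] ℂ :=
  (LinearMap.proj z).comp (finiteEnergy μ).subtype

/-- The derivative at a point of the disc, as a functional on `finiteEnergy μ`. -/
def derivFunctional (μ : Measure ℂ) [SFinite μ] {z : ℂ} (hz : z ∈ disc) :
    finiteEnergy μ →ₗ[ℝ] ℂ where
  toFun u := deriv u.1 z
  map_add' u v := deriv_add (u.2.1.differentiableAt (isOpen_disc.mem_nhds hz))
    (v.2.1.differentiableAt (isOpen_disc.mem_nhds hz))
  map_smul' c u := deriv_const_smul c (u.2.1.differentiableAt (isOpen_disc.mem_nhds hz))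

lemma exists_strong_limit {μ : Measure ℂ} [IsFiniteMeasure μ] (hμ : OnCircle μ)
    {x : ℕ → ℂ → ℂ} {v : ℂ → ℂ} (hx : ∀ n, DifferentiableOn ℂ (x n) disc) {K : ℝ≥0∞}
    (hKt : K ≠ ∞) (hK : ∀ n, energy μ (x n) ≤ K) (hv : DifferentiableOn ℂ v disc)
    (h : ∀ z ∈ disc, Tendsto (fun n => x n z) atTop (𝓝 (v z)))
    (h' : ∀ z ∈ disc, Tendsto (fun n => deriv (x n) z) atTop (𝓝 (deriv v z)))
    {ε : ℝ≥0∞} (hε : 0 < ε) :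
    ∃ y ∈ convexHull ℝ (range x), energy μ (v - y) < ε := by
  let X : ℕ → finiteEnergy μ := fun n => ⟨x n, hx n, ne_top_of_le_ne_top hKt (hK n)⟩
  let N : finiteEnergy μ → ℝ := fun u => (energy μ u.1).toReal
  obtain ⟨Y, hY, hC⟩ : ∃ y : ℕ → finiteEnergy μ, (∀ n, y n ∈ convexHull ℝ (X '' Ici n)) ∧
      ∀ ε > 0, ∃ M, ∀ n ≥ M, ∀ m ≥ n, N (y m - y n) < ε := by
    refine exists_cauchy_convexHull (N := N) (x := X) (K := K.toReal) (fun _ => ENNReal.toReal_nonneg)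
      (fun u w => ?_) (fun u => ?_) fun n => ENNReal.toReal_mono hKt (hK n)
    · have := congrArg ENNReal.toReal (energy_parallelogram μ u.2.1 w.2.1)
      change (energy μ (u + w).1 + energy μ (u - w).1).toReal = _ at this
      rwa [ENNReal.toReal_add (u + w).2.2 (u - w).2.2,
        ENNReal.toReal_add (ENNReal.mul_ne_top (by simp) u.2.2)
          (ENNReal.mul_ne_top (by simp) w.2.2), ENNReal.toReal_mul, ENNReal.toReal_mul] at this
    · have : (((1 / 2 : ℝ) • u : finiteEnergy μ) : ℂ → ℂ) = fun z => ((1 / 2 : ℝ) : ℂ) * u.1 z := by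
        ext z; simp
      simp only [N]
      rw [this, energy_const_mul, ENNReal.toReal_mul, ENNReal.toReal_pow, toReal_enorm, norm_real]
      norm_num
      ring
  obtain ⟨δ, hδ0, hδ⟩ : ∃ δ : ℝ, 0 < δ ∧ 2 * ENNReal.ofReal δ < ε := by
    obtain ⟨q, hq0, hq⟩ := ENNReal.lt_iff_exists_nnreal_btwn.1 (ENNReal.half_pos hε.ne')
    refine ⟨q, by exact_mod_cast hq0, ?_⟩
    rw [ENNReal.ofReal_coe_nnreal, mul_comm]
    exact (ENNReal.lt_div_iff_mul_lt (by simp) (by simp)).1 hq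
  obtain ⟨M, hM⟩ := hC δ hδ0
  have hev {z : ℂ} (hz : z ∈ disc) : Tendsto (fun n => (Y n).1 z) atTop (𝓝 (v z)) :=
    tendsto_of_mem_convexHull (evalFunctional μ z) hY (h z hz)
  have hder {z : ℂ} (hz : z ∈ disc) : Tendsto (fun n => deriv (Y n).1 z) atTop (𝓝 (deriv v z)) :=
    tendsto_of_mem_convexHull (derivFunctional μ hz) hY (h' z hz)
  refine ⟨(Y M).1, ?_, lt_of_le_of_lt ?_ hδ⟩
  · have h1 := mem_image_of_mem (finiteEnergy μ).subtype (hY M)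
    rw [LinearMap.image_convexHull, image_image] at h1
    refine convexHull_mono ?_ h1
    rintro _ ⟨k, -, rfl⟩
    exact ⟨k, rfl⟩
  · have hYd := (Y M).2.1
    refine energy_le_of_tendsto hμ (u := fun n => (Y n).1 - (Y M).1) (v := v - (Y M).1)
      (fun n => (Y n).2.1.sub hYd) (fun z hz => (hev hz).sub_const _) (fun z hz => ?_) ?_
    · have hd {w : ℂ → ℂ} (hw : DifferentiableOn ℂ w disc) :
          deriv (w - (Y M).1) z = deriv w z - deriv (Y M).1 z :=
        deriv_sub (hw.differentiableAt (isOpen_disc.mem_nhds hz))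
          (hYd.differentiableAt (isOpen_disc.mem_nhds hz))
      simp only [hd hv, hd (Y _).2.1]
      exact (hder hz).sub_const _
    · filter_upwards [eventually_ge_atTop M] with n hn
      exact (ENNReal.le_ofReal_iff_toReal_le (Y n - Y M).2.2 hδ0.le).2 (hM M le_rfl n hn).le

lemma memSpanClosure_of_norm_le {μ : Measure ℂ} [IsFiniteMeasure μ] (hμ : OnCircle μ)
    {F g : ℂ → ℂ} (hF : MemD μ F) (hg : MemD μ g) {C : ℝ} (hC : 0 ≤ C)
    (hle : ∀ z ∈ disc, ‖F z‖ ≤ C * ‖g z‖) : MemSpanClosure μ g F := by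
  obtain ⟨hFd, hFe⟩ := (memD_iff hμ).1 hF
  obtain ⟨hgd, hge⟩ := (memD_iff hμ).1 hg
  obtain ⟨φ, hφ, hφC, hFφ⟩ := exists_bounded_quotient hFd hgd hC hle
  let r : ℕ → ℝ := fun n => 1 - 1 / 2 * (1 / ((n : ℝ) + 1))
  have hr (n) : 1 / 2 ≤ r n ∧ r n < 1 := by
    have h1 := Nat.one_div_pos_of_nat (α := ℝ) (n := n)
    have h2 : 1 / ((n : ℝ) + 1) ≤ 1 := by
      rw [div_le_one (by positivity)]
      linarith [n.cast_nonneg (α := ℝ)]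
    constructor <;> simp only [r] <;> linarith
  have hr0 (n) : 0 ≤ r n := by linarith [(hr n).1]
  have hrlim : Tendsto r atTop (𝓝 1) := by
    have h1 := (tendsto_one_div_add_atTop_nhds_zero_nat (𝕜 := ℝ)).const_mul (1 / 2)
    rw [mul_zero] at h1
    exact sub_zero (1 : ℝ) ▸ h1.const_sub 1
  have hrz (z : ℂ) : Tendsto (fun n => (r n : ℂ) * z) atTop (𝓝 z) := by
    simpa using ((continuous_ofReal.tendsto 1).comp hrlim).mul_const z
  let x : ℕ → ℂ → ℂ := fun n z => φ (r n * z) * g z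
  have hxd (n) : DifferentiableOn ℂ (x n) disc :=
    (hφ.comp (by fun_prop) fun z hz => ofReal_mul_mem_disc (hr0 n) (hr n).2.le hz).mul hgd
  have hlim {u : ℂ → ℂ} (hu : ContinuousOn u disc) {z : ℂ} (hz : z ∈ disc) :
      Tendsto (fun n => u (r n * z)) atTop (𝓝 (u z)) :=
    (hu.continuousAt (isOpen_disc.mem_nhds hz)).tendsto.comp (hrz z)
  have hKt : ENNReal.ofReal C ^ 2 * hardyEnergy g + (20 * ENNReal.ofReal C ^ 2 *
      dirichletEnergy μ g + 8 * dirichletEnergy μ F) ≠ ∞ := by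
    have h1 := ENNReal.add_ne_top.1 hge
    have h2 := (ENNReal.add_ne_top.1 hFe).2
    have h3 := h1.1
    have h4 := h1.2
    finiteness
  intro ε hε
  have hε4 : 0 < ε / 4 := ENNReal.div_pos hε.ne' (by simp)
  obtain ⟨y, hy, hyF⟩ := exists_strong_limit hμ hxd hKt
    (fun n => energy_dilate_mul_le hμ hφ hgd hFφ hφC (hr n).1 (hr n).2) hFd
    (fun z hz => by
      rw [hFφ z hz]
      exact (hlim hφ.continuousOn hz).mul_const _)
    (fun z hz => by
      have hc := (hFd.deriv isOpen_disc).continuousOn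
      have hc' := (hφ.deriv isOpen_disc).continuousOn
      have hc'' := (hgd.deriv isOpen_disc).continuousOn
      simp only [x, deriv_dilate_mul hφ hgd hFφ (hr0 _) (hr _).2 hz]
      have hrc : Tendsto (fun n => (r n : ℂ)) atTop (𝓝 1) := by
        exact ofReal_one ▸ (continuous_ofReal.tendsto 1).comp hrlim
      have := (((hrc.mul (hlim hc' hz)).mul ((hlim hgd.continuousOn hz).const_sub (g z))).add
        (hrc.mul (hlim hc hz))).add
        (((hrc.mul (hlim hφ.continuousOn hz)).mul (hlim hc'' hz)).neg.add
          ((hlim hφ.continuousOn hz).mul_const (deriv g z)))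
      simpa using this) hε4
  obtain ⟨hyd, hyc⟩ := convexHull_min (by
    rintro _ ⟨n, rfl⟩
    exact ⟨hxd n, memSpanClosure_dilate_mul hμ hφ hgd hge (hr0 n) (hr n).2⟩)
    (convex_setOf_memSpanClosure (μ := μ) hgd) hy
  obtain ⟨p, hp⟩ := hyc (ε / 4) hε4
  refine ⟨p, ?_⟩
  have hsplit : (fun z => F z - p.eval z * g z) = (F - y) + fun z => y z - p.eval z * g z := by
    ext z; simp
  rw [hsplit]
  calc _ ≤ 2 * energy μ (F - y) + 2 * energy μ (fun z => y z - p.eval z * g z) :=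
        energy_add_le μ (hFd.sub hyd) (hyd.sub (p.differentiable.differentiableOn.mul hgd))
    _ < 2 * (ε / 4) + 2 * (ε / 4) := by gcongr <;> simp
    _ = ε := by
        rw [← add_mul, mul_comm, show (2 + 2 : ℝ≥0∞) = 4 by norm_num,
          ENNReal.div_mul_cancel] <;> norm_num

lemma exists_bound_eval (p : Polynomial ℂ) :
    ∃ C : ℝ, 0 ≤ C ∧ ∀ z ∈ disc, ‖p.eval z‖ ≤ C := by
  obtain ⟨C, hC⟩ := (isCompact_closedBall (0 : ℂ) 1).exists_bound_of_continuousOn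
    p.continuous.continuousOn
  exact ⟨C, (norm_nonneg _).trans (hC 0 (mem_closedBall_self zero_le_one)),
    fun z hz => hC z (ball_subset_closedBall hz)⟩

lemma MemD.polynomial_mul {μ : Measure ℂ} [IsFiniteMeasure μ] (hμ : OnCircle μ) {f : ℂ → ℂ}
    (hf : MemD μ f) (p : Polynomial ℂ) : MemD μ (fun z => p.eval z * f z) := by
  obtain ⟨hfd, hfe⟩ := (memD_iff hμ).1 hf
  refine (memD_iff hμ).2 ⟨p.differentiable.differentiableOn.mul hfd, ?_⟩
  obtain ⟨C, -, hC⟩ := exists_bound_eval p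
  obtain ⟨C', -, hC'⟩ := exists_bound_eval p.derivative
  have h := lintegral_sq_weight_ne_top hμ hfd (ENNReal.add_ne_top.1 hfe).2
  refine ne_top_of_le_ne_top ?_ (energy_mul_le (C := ENNReal.ofReal (max C C'))
    p.differentiable.differentiableOn hfd (fun z hz => ?_) (fun z hz => ?_) (by simp))
  · finiteness
  · rw [← ofReal_norm]
    exact ENNReal.ofReal_le_ofReal ((hC z hz).trans (le_max_left _ _))
  · rw [← ofReal_norm, p.deriv]
    exact ENNReal.ofReal_le_ofReal ((hC' z hz).trans (le_max_right _ _))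

lemma MemD.sub {μ : Measure ℂ} [IsFiniteMeasure μ] (hμ : OnCircle μ) {u v : ℂ → ℂ}
    (hu : MemD μ u) (hv : MemD μ v) : MemD μ (fun z => u z - v z) := by
  rw [memD_iff hμ] at *
  exact (finiteEnergy μ).sub_mem hu hv

/-- If `f, g ∈ D(μ)` and `|f| ≤ |g|` on `𝔻`, then `[f]_{D(μ)} ⊆ [g]_{D(μ)}`. -/
theorem closedSpan_mono_of_abs_le
    (μ : Measure ℂ) [IsFiniteMeasure μ] (hμ : OnCircle μ)
    (f g : ℂ → ℂ) (hf : MemD μ f) (hg : MemD μ g)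
    (hle : ∀ z ∈ disc, ‖f z‖ ≤ ‖g z‖) :
    closedSpan μ f ⊆ closedSpan μ g := by
  rintro h ⟨hh, happ⟩
  refine ⟨hh, fun ε hε => ?_⟩
  obtain ⟨q, hq⟩ := happ (ε / (8 * Real.pi)) (by have := Real.pi_pos; positivity)
  obtain ⟨C, hC0, hC⟩ := exists_bound_eval q
  have hqf := hf.polynomial_mul hμ q
  obtain ⟨p, hp⟩ := memSpanClosure_of_norm_le hμ hqf hg hC0 (fun z hz => by
    rw [norm_mul]
    exact mul_le_mul (hC z hz) (hle z hz) (norm_nonneg _) hC0) (ENNReal.ofReal (ε / 4))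
    (by simpa using hε)
  have h1 := hh.sub hμ hqf
  have h2 := hqf.sub hμ (hg.polynomial_mul hμ p)
  have h3 := hh.sub hμ (hg.polynomial_mul hμ p)
  refine ⟨p, (dNormSq_le hμ h3).trans_lt (ENNReal.toReal_lt_of_lt_ofReal ?_)⟩
  have hsplit : (fun z => h z - p.eval z * g z) = (fun z => h z - q.eval z * f z) +
      fun z => q.eval z * f z - p.eval z * g z := by
    ext z; simp
  rw [hsplit]
  calc _ ≤ 2 * energy μ (fun z => h z - q.eval z * f z) +
          2 * energy μ (fun z => q.eval z * f z - p.eval z * g z) :=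
        energy_add_le μ h1.1.1 h2.1.1
    _ < 2 * ENNReal.ofReal (ε / 4) + 2 * ENNReal.ofReal (ε / 4) := by
        refine ENNReal.add_lt_add_of_le_of_lt (ENNReal.mul_ne_top (by simp) ((memD_iff hμ).1 h1).2) ?_
          (by gcongr; simp)
        refine mul_le_mul' le_rfl ((energy_le_dNormSq hμ h1).trans (ENNReal.ofReal_le_ofReal ?_))
        calc 2 * Real.pi * _ ≤ 2 * Real.pi * (ε / (8 * Real.pi)) := by gcongr
          _ = ε / 4 := by field_simp; norm_num
    _ = ENNReal.ofReal ε := by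
        rw [← ENNReal.ofReal_ofNat 2, ← ENNReal.ofReal_mul (by norm_num),
          ← ENNReal.ofReal_add (by positivity) (by positivity)]
        ring_nf

end DirichletMu
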